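/- (Lemma 4.1) If 𝒥₀=ℕ or ι₆≠ℓ₁, then H²(𝒦,F)=0; that is, for every 2-cocycle ψ on 𝒦 there exists a linear function f:𝒦→F such that ψ(u,v)=f([u,v]) for all u,v∈𝒦. -/

import Mathlib

noncomputable section

/-- `ι_i = ℓ₁ + ⋯ + ℓ_i`. -/
def iot (ℓ : ℕ → ℕ) (i : ℕ) : ℕ := ∑ k ∈ Finset.Icc 1 i, ℓ k

/-- `I_{i,j} = {ι_{i-1}+1, …, ι_j}`. -/
def iSet (ℓ : ℕ → ℕ) (i j : ℕ) : Finset ℕ := Finset.Icc (iot ℓ (i - 1) + 1) (iot ℓ j)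

/-- The index-shift map `p ↦ p̄` (shift by `ι₆`). -/
def bar (ℓ : ℕ → ℕ) (p : ℕ) : ℕ := if p ≤ iot ℓ 6 then p + iot ℓ 6 else p - iot ℓ 6

/-- `K̄ = {p̄ : p ∈ K}`. -/
def barSet (ℓ : ℕ → ℕ) (K : Finset ℕ) : Finset ℕ := K.image (bar ℓ)

/-- `J_{i,j} = I_{i,j} ∪ Ī_{i,j}`. -/
def jSet (ℓ : ℕ → ℕ) (i j : ℕ) : Finset ℕ := iSet ℓ i j ∪ barSet ℓ (iSet ℓ i j)

/-- The semigroup `𝒥 = 𝒥₀ × 𝒥₁`, encoded as functions `ℕ → ℕ`; `j0 = true`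
means `𝒥₀ = ℕ` and `j0 = false` means `𝒥₀ = {0}`. -/
def jIdx (ℓ : ℕ → ℕ) (j0 : Bool) : Set (ℕ → ℕ) :=
  {i | (j0 = false → i 0 = 0) ∧
    ∀ p, 1 ≤ p →
      (p ∈ iSet ℓ 1 2 ∪ iSet ℓ 4 4 ∪ barSet ℓ (iSet ℓ 1 1) ∨ 2 * iot ℓ 6 < p) → i p = 0}

/-- `σ_p` (with `σ_p = σ_{p̄}`). -/
def sgm (F : Type*) [Field F] (ℓ : ℕ → ℕ) (p : ℕ) : ℕ → F :=
  let q := if p ≤ iot ℓ 6 then p else p - iot ℓ 6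
  if q ∈ iSet ℓ 1 3 then -Pi.single q (1 : F) - Pi.single (q + iot ℓ 6) (1 : F)
  else if q ∈ iSet ℓ 4 5 then -Pi.single q (1 : F)
  else 0

/-- The underlying space `𝒜`: the free `F`-module with basis `Γ × 𝒥`. -/
abbrev CA (F : Type*) [Field F] (ℓ : ℕ → ℕ) (Γ : AddSubgroup (ℕ → F)) (j0 : Bool) : Type _ :=
  (↥Γ × ↥(jIdx ℓ j0)) →₀ F

/-- The basis monomial `x^{α,i⃗}`, with the convention that it is `0` if `(α,i⃗) ∉ Γ × 𝒥`. -/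
def X (F : Type*) [Field F] (ℓ : ℕ → ℕ) (Γ : AddSubgroup (ℕ → F)) (j0 : Bool)
    (α : ℕ → F) (i : ℕ → ℕ) : CA F ℓ Γ j0 :=
  @dite _ (α ∈ Γ ∧ i ∈ jIdx ℓ j0) (Classical.dec _)
    (fun h => Finsupp.single (⟨α, h.1⟩, ⟨i, h.2⟩) 1) (fun _ => 0)

variable (F : Type*) [Field F] (ℓ : ℕ → ℕ) (Γ : AddSubgroup (ℕ → F)) (j0 : Bool)

/-- The commutative associative product on `𝒜`. -/
def mulA (u v : CA F ℓ Γ j0) : CA F ℓ Γ j0 :=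
  u.sum fun a ca => v.sum fun b cb =>
    (ca * cb) • X F ℓ Γ j0 (a.1.1 + b.1.1) (a.2.1 + b.2.1)

/-- The grading operator `∂*_p`. -/
def pstar (p : ℕ) (u : CA F ℓ Γ j0) : CA F ℓ Γ j0 :=
  u.sum fun a ca => (ca * a.1.1 p) • Finsupp.single a 1

/-- The down-grading operator `∂_{t_p}`. -/
def pt (p : ℕ) (u : CA F ℓ Γ j0) : CA F ℓ Γ j0 :=
  u.sum fun a ca => (ca * (a.2.1 p : F)) • X F ℓ Γ j0 a.1.1 (a.2.1 - Pi.single p 1)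

/-- `∂_p = ∂*_p + ∂_{t_p}`. -/
def dd (p : ℕ) (u : CA F ℓ Γ j0) : CA F ℓ Γ j0 := pstar F ℓ Γ j0 p u + pt F ℓ Γ j0 p u

/-- `∂ = Σ_{p∈J_{1,3}∪I_{4,5}} ∂*_p + Σ_{p∈I₆∪Ī_{4,6}} t_p ∂_{t_p}`. -/
def Dop (u : CA F ℓ Γ j0) : CA F ℓ Γ j0 :=
  (∑ p ∈ jSet ℓ 1 3 ∪ iSet ℓ 4 5, pstar F ℓ Γ j0 p u) +
    ∑ p ∈ iSet ℓ 6 6 ∪ barSet ℓ (iSet ℓ 4 6),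
      mulA F ℓ Γ j0 (X F ℓ Γ j0 0 (Pi.single p 1)) (pt F ℓ Γ j0 p u)

/-- The contact bracket (2.18):
`[u,v] = Σ_{p∈I} x^{σ_p}(∂_p u·∂_{p̄} v − ∂_{p̄} u·∂_p v) + (2−∂)(u)·∂₀(v) − ∂₀(u)·(2−∂)(v)`. -/
def brk (u v : CA F ℓ Γ j0) : CA F ℓ Γ j0 :=
  (∑ p ∈ iSet ℓ 1 6,
      mulA F ℓ Γ j0 (X F ℓ Γ j0 (sgm F ℓ p) 0)
        (mulA F ℓ Γ j0 (dd F ℓ Γ j0 p u) (dd F ℓ Γ j0 (bar ℓ p) v) -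
          mulA F ℓ Γ j0 (dd F ℓ Γ j0 (bar ℓ p) u) (dd F ℓ Γ j0 p v))) +
    mulA F ℓ Γ j0 ((2 : F) • u - Dop F ℓ Γ j0 u) (dd F ℓ Γ j0 0 v) -
    mulA F ℓ Γ j0 (dd F ℓ Γ j0 0 u) ((2 : F) • v - Dop F ℓ Γ j0 v)


noncomputable section
namespace KH2
set_option linter.unusedSectionVars false
set_option linter.unusedSimpArgs false

section Jac
variable {F R : Type*} [Field F] [CharZero F] [CommRing R] [Algebra F R]
variable (S : Finset ℕ) (D D' : ℕ → Derivation F R R) (d0 E : Derivation F R R)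

def pb (u v : R) : R := ∑ q ∈ S, (D q u * D' q v - D' q u * D q v)

def cb (u v : R) : R :=
  pb S D D' u v + (2 * u - E u) * d0 v - d0 u * (2 * v - E v)

lemma pb_skew (u v : R) : pb S D D' v u = - pb S D D' u v := by
  simp only [pb, ← Finset.sum_neg_distrib]
  exact Finset.sum_congr rfl fun q _ => by ring

lemma pb_add_left (u u' v : R) : pb S D D' (u + u') v = pb S D D' u v + pb S D D' u' v := by
  simp only [pb, ← Finset.sum_add_distrib]
  exact Finset.sum_congr rfl fun q _ => by simp only [map_add]; ring

lemma pb_sub_left (u u' v : R) : pb S D D' (u - u') v = pb S D D' u v - pb S D D' u' v := by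
  simp only [pb, ← Finset.sum_sub_distrib]
  exact Finset.sum_congr rfl fun q _ => by simp only [map_sub]; ring

lemma pb_mul_left (a b v : R) :
    pb S D D' (a * b) v = a * pb S D D' b v + b * pb S D D' a v := by
  simp only [pb, Finset.mul_sum, ← Finset.sum_add_distrib]
  exact Finset.sum_congr rfl fun q _ => by
    simp only [Derivation.leibniz, smul_eq_mul]; ring

lemma pb_two_left (b v : R) : pb S D D' (2 * b) v = 2 * pb S D D' b v := by
  rw [two_mul, pb_add_left, two_mul]

lemma pb_sub_right (u v v' : R) : pb S D D' u (v - v') = pb S D D' u v - pb S D D' u v' := by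
  simp only [pb, ← Finset.sum_sub_distrib]
  exact Finset.sum_congr rfl fun q _ => by simp only [map_sub]; ring

lemma dsum_zero (F : Type*) [Field F] [CharZero F] [Algebra F R] (G : ℕ → ℕ → R) (h : ∀ q q', G q q' + G q' q = 0) :
    ∑ q ∈ S, ∑ q' ∈ S, G q q' = 0 := by
  have h2 : (∑ q ∈ S, ∑ q' ∈ S, G q q') + (∑ q ∈ S, ∑ q' ∈ S, G q q') = 0 := by
    nth_rewrite 2 [Finset.sum_comm]
    rw [← Finset.sum_add_distrib]
    refine Finset.sum_eq_zero fun q _ => ?_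
    rw [← Finset.sum_add_distrib]
    exact Finset.sum_eq_zero fun q' _ => h q q'
  have h3 : (2 : F) • (∑ q ∈ S, ∑ q' ∈ S, G q q') = 0 := by rw [two_smul, h2]
  exact (smul_eq_zero_iff_right (two_ne_zero)).1 h3

lemma pb_jac (hDD : ∀ q q' x, D q (D q' x) = D q' (D q x))
    (hDD' : ∀ q q' x, D' q (D q' x) = D q' (D' q x))
    (hD'D' : ∀ q q' x, D' q (D' q' x) = D' q' (D' q x)) (u v w : R) :
    pb S D D' (pb S D D' u v) w + pb S D D' (pb S D D' v w) u
      + pb S D D' (pb S D D' w u) v = 0 := by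
  have key : ∀ u v w : R, pb S D D' (pb S D D' u v) w = ∑ q ∈ S, ∑ q' ∈ S,
      ((D q (D q' u) * D' q' v + D q' u * D q (D' q' v)
        - D q (D' q' u) * D q' v - D' q' u * D q (D q' v)) * D' q w
      - (D' q (D q' u) * D' q' v + D q' u * D' q (D' q' v)
        - D' q (D' q' u) * D q' v - D' q' u * D' q (D q' v)) * D q w) := by
    intro u v w
    conv_lhs => unfold pb
    refine Finset.sum_congr rfl fun q _ => ?_
    rw [map_sum, map_sum, Finset.sum_mul, Finset.sum_mul, ← Finset.sum_sub_distrib]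
    refine Finset.sum_congr rfl fun q' _ => ?_
    simp only [map_sub, Derivation.leibniz, smul_eq_mul]
    ring
  rw [key, key, key, ← Finset.sum_add_distrib, ← Finset.sum_add_distrib]
  simp only [← Finset.sum_add_distrib]
  refine dsum_zero S F _ fun q q' => ?_
  simp only [hDD q' q, hDD' q', hD'D' q' q]
  simp only [hDD' q]
  ring

lemma cb_jac (hDD : ∀ q q' x, D q (D q' x) = D q' (D q x))
    (hDD' : ∀ q q' x, D' q (D q' x) = D q' (D' q x))
    (hD'D' : ∀ q q' x, D' q (D' q' x) = D' q' (D' q x))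
    (h0 : ∀ q x, d0 (D q x) = D q (d0 x)) (h0' : ∀ q x, d0 (D' q x) = D' q (d0 x))
    (h0E : ∀ x, E (d0 x) = d0 (E x))
    (hE : ∀ q ∈ S, ∀ x, E (D q x) = D q (E x) - D q x)
    (hE' : ∀ q ∈ S, ∀ x, E (D' q x) = D' q (E x) - D' q x)
    (u v w : R) :
    cb S D D' d0 E (cb S D D' d0 E u v) w + cb S D D' d0 E (cb S D D' d0 E v w) u
      + cb S D D' d0 E (cb S D D' d0 E w u) v = 0 := by
  have hJ := pb_jac S D D' hDD hDD' hD'D' u v w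
  have hd0 : ∀ u v, d0 (pb S D D' u v) = pb S D D' (d0 u) v + pb S D D' u (d0 v) := by
    intro u v
    simp only [pb, ← Finset.sum_add_distrib, map_sum]
    exact Finset.sum_congr rfl fun q _ => by
      simp only [map_sub, Derivation.leibniz, smul_eq_mul, h0, h0']; ring
  have hEp : ∀ u v, E (pb S D D' u v)
      = pb S D D' (E u) v + pb S D D' u (E v) - 2 * pb S D D' u v := by
    intro u v
    simp only [pb, ← Finset.sum_add_distrib, ← Finset.sum_sub_distrib, map_sum, Finset.mul_sum]
    exact Finset.sum_congr rfl fun q hq => by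
      simp only [map_sub, Derivation.leibniz, smul_eq_mul, hE q hq, hE' q hq]; ring
  have h20 : ∀ d : Derivation F R R, d 2 = 0 := fun d => by
    have := d.map_natCast 2
    simpa using this
  have key : ∀ u v w, cb S D D' d0 E (cb S D D' d0 E u v) w =
      pb S D D' (pb S D D' u v) w
      + (2 * u - E u) * pb S D D' (d0 v) w + d0 v * (2 * pb S D D' u w - pb S D D' (E u) w)
      - (2 * v - E v) * pb S D D' (d0 u) w - d0 u * (2 * pb S D D' v w - pb S D D' (E v) w)
      + (2 * (pb S D D' u v + (2 * u - E u) * d0 v - d0 u * (2 * v - E v))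
          - (pb S D D' (E u) v + pb S D D' u (E v) - 2 * pb S D D' u v
              + ((2 * E u - E (E u)) * d0 v + (2 * u - E u) * d0 (E v))
              - (d0 (E u) * (2 * v - E v) + d0 u * (2 * E v - E (E v))))) * d0 w
      - (pb S D D' (d0 u) v + pb S D D' u (d0 v)
          + ((2 * d0 u - d0 (E u)) * d0 v + (2 * u - E u) * d0 (d0 v))
          - (d0 (d0 u) * (2 * v - E v) + d0 u * (2 * d0 v - d0 (E v)))) * (2 * w - E w) := by
    intro u v w
    have e1 : pb S D D' (cb S D D' d0 E u v) w = pb S D D' (pb S D D' u v) w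
      + (2 * u - E u) * pb S D D' (d0 v) w + d0 v * (2 * pb S D D' u w - pb S D D' (E u) w)
      - (2 * v - E v) * pb S D D' (d0 u) w - d0 u * (2 * pb S D D' v w - pb S D D' (E v) w) := by
      rw [cb]
      simp only [pb_sub_left, pb_add_left, pb_mul_left, pb_two_left]
      have : pb S D D' 2 w = 0 := by simp [pb, h20]
      rw [this]
      ring
    have e2 : E (cb S D D' d0 E u v) = (pb S D D' (E u) v + pb S D D' u (E v) - 2 * pb S D D' u v
              + ((2 * E u - E (E u)) * d0 v + (2 * u - E u) * d0 (E v))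
              - (d0 (E u) * (2 * v - E v) + d0 u * (2 * E v - E (E v)))) := by
      rw [cb]
      simp only [map_sub, map_add, Derivation.leibniz, smul_eq_mul, hEp, h0E, h20]
      ring
    have e3 : d0 (cb S D D' d0 E u v) = (pb S D D' (d0 u) v + pb S D D' u (d0 v)
          + ((2 * d0 u - d0 (E u)) * d0 v + (2 * u - E u) * d0 (d0 v))
          - (d0 (d0 u) * (2 * v - E v) + d0 u * (2 * d0 v - d0 (E v)))) := by
      rw [cb]
      simp only [map_sub, map_add, Derivation.leibniz, smul_eq_mul, hd0, h0E, h20]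
      ring
    conv_lhs => rw [cb]
    rw [e1, e2, e3, cb]
  rw [key, key, key]
  have s := pb_skew S D D'
  simp only [s u w, s (d0 u) w, s u (d0 w), s (E u) w, s u (E w),
    s u v, s (d0 u) v, s u (d0 v), s (E u) v, s u (E v),
    s v w, s (d0 v) w, s v (d0 w), s (E v) w, s v (E w)] at hJ ⊢
  linear_combination hJ
end Jac
end KH2
end

noncomputable section
namespace KH2
set_option linter.unusedSectionVars false
set_option linter.unusedSimpArgs false

section Ring
variable (F : Type*) [Field F]

/-- The big ambient monomial algebra. -/
def BB : Type _ := AddMonoidAlgebra F ((ℕ → F) × (ℕ → ℕ))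

instance : CommRing (BB F) := inferInstanceAs (CommRing (AddMonoidAlgebra F ((ℕ → F) × (ℕ → ℕ))))
instance : Algebra F (BB F) :=
  inferInstanceAs (Algebra F (AddMonoidAlgebra F ((ℕ → F) × (ℕ → ℕ))))

/-- The coefficient equivalence. -/
def cf : BB F ≃ₗ[F] (((ℕ → F) × (ℕ → ℕ)) →₀ F) :=
  (AddMonoidAlgebra.coeffLinearEquiv F :
    AddMonoidAlgebra F ((ℕ → F) × (ℕ → ℕ)) ≃ₗ[F] (((ℕ → F) × (ℕ → ℕ)) →₀ F))

variable {F}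

def mon (α : ℕ → F) (i : ℕ → ℕ) : BB F :=
  (AddMonoidAlgebra.single (α, i) 1 : AddMonoidAlgebra F ((ℕ → F) × (ℕ → ℕ)))

lemma cf_mon (α : ℕ → F) (i : ℕ → ℕ) : cf F (mon α i) = Finsupp.single (α, i) 1 := rfl

lemma mon_mul (α β : ℕ → F) (i j : ℕ → ℕ) : mon α i * mon β j = mon (α + β) (i + j) := by
  have := AddMonoidAlgebra.single_mul_single (α, i) (β, j) (1 : F) (1 : F)
  rw [mul_one] at this
  exact this

lemma mon_zero : mon (0 : ℕ → F) 0 = 1 := by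
  have := AddMonoidAlgebra.one_def (R := F) (M := (ℕ → F) × (ℕ → ℕ))
  exact this.symm

def opB (h : (ℕ → F) → (ℕ → ℕ) → BB F) : BB F →ₗ[F] BB F :=
  (Finsupp.linearCombination F (fun w : (ℕ → F) × (ℕ → ℕ) => h w.1 w.2)) ∘ₗ
    (cf F).toLinearMap

lemma opB_mon (h : (ℕ → F) → (ℕ → ℕ) → BB F) (α i) : opB h (mon α i) = h α i := by
  simp [opB, cf_mon]

lemma B_ind {P : BB F → Prop} (hadd : ∀ x y, P x → P y → P (x + y))
    (hsm : ∀ (c : F) α i, P (c • mon α i)) (x : BB F) : P x := by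
  suffices H : ∀ y, P ((cf F).symm y) by simpa using H (cf F x)
  intro y
  induction y using Finsupp.induction_linear with
  | zero => simpa using hsm 0 0 0
  | add x y hx hy => rw [map_add]; exact hadd _ _ hx hy
  | single m r =>
    have := hsm r m.1 m.2
    rwa [(LinearEquiv.symm_apply_eq (cf F)).2]
    rw [map_smul, cf_mon]; simp

lemma leib_of_mon (d : BB F →ₗ[F] BB F)
    (h : ∀ α i β j, d (mon α i * mon β j) = mon α i * d (mon β j) + mon β j * d (mon α i))
    (a b : BB F) : d (a * b) = a • d b + b • d a := by
  simp only [smul_eq_mul]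
  induction a using B_ind with
  | hadd x y hx hy => rw [add_mul, map_add, hx, hy, map_add]; ring
  | hsm c α i =>
    induction b using B_ind with
    | hadd x y hx hy => rw [mul_add, map_add, hx, hy, map_add]; ring
    | hsm c' β j =>
      simp only [smul_mul_assoc, mul_smul_comm, map_smul, h, smul_add]
      congr 1
      rw [smul_comm]

def mkDer (d : BB F →ₗ[F] BB F)
    (h : ∀ α i β j, d (mon α i * mon β j) = mon α i * d (mon β j) + mon β j * d (mon α i)) :
    Derivation F (BB F) (BB F) where
  toLinearMap := d
  map_one_eq_zero' := by
    have := h 0 0 0 0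
    rw [mon_zero] at this
    simpa using this
  leibniz' := leib_of_mon d h

lemma mkDer_apply (d : BB F →ₗ[F] BB F) (h) (x : BB F) : mkDer d h x = d x := rfl

def dS (r : ℕ) : Derivation F (BB F) (BB F) :=
  mkDer (opB fun α i => α r • mon α i) (by
    intro α i β j
    simp only [mon_mul, opB_mon, mul_smul_comm, Pi.add_apply, add_smul]
    rw [add_comm β α, add_comm j i, add_comm])

lemma dS_mon (r : ℕ) (α : ℕ → F) (i) : dS r (mon α i) = α r • mon α i := by
  rw [dS, mkDer_apply, opB_mon]

abbrev es (r : ℕ) : ℕ → ℕ := Pi.single r 1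

lemma sub_es_add (i j : ℕ → ℕ) (r : ℕ) (h : i r ≠ 0) : i + j - es r = (i - es r) + j := by
  funext k
  by_cases hk : k = r
  · subst hk; simp; omega
  · simp [hk]

def dT (r : ℕ) : Derivation F (BB F) (BB F) :=
  mkDer (opB fun α i => (i r : F) • mon α (i - es r)) (by
    intro α i β j
    simp only [mon_mul, opB_mon, mul_smul_comm, Pi.add_apply, Nat.cast_add, add_smul]
    rw [add_comm]
    congr 1
    · by_cases h : j r = 0
      · simp [h]
      · rw [add_comm i j, sub_es_add _ _ _ h, add_comm i]
    · by_cases h : i r = 0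
      · simp [h]
      · rw [sub_es_add _ _ _ h, add_comm β α, add_comm j])

lemma dT_mon (r : ℕ) (α : ℕ → F) (i) : dT r (mon α i) = (i r : F) • mon α (i - es r) := by
  rw [dT, mkDer_apply, opB_mon]

lemma der_ext_comm (d d' : Derivation F (BB F) (BB F)) (e : Derivation F (BB F) (BB F)) (c : F)
    (h : ∀ α i, d (d' (mon α i)) = d' (d (mon α i)) + c • e (mon α i)) (x : BB F) :
    d (d' x) = d' (d x) + c • e x := by
  induction x using B_ind with
  | hadd x y hx hy => simp only [map_add, hx, hy, smul_add]; abel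
  | hsm k α i => simp only [Derivation.map_smul, h, smul_add]; rw [smul_comm]

lemma dS_dS (r s : ℕ) (x : BB F) : dS r (dS s x) = dS s (dS r x) := by
  have := der_ext_comm (dS r) (dS s) 0 0 (fun α i => by
    simp only [dS_mon, Derivation.map_smul, smul_smul, zero_smul, add_zero, mul_comm]) x
  simpa using this

lemma dS_dT (r s : ℕ) (x : BB F) : dS r (dT s x) = dT s (dS r x) := by
  have := der_ext_comm (dS r) (dT s) 0 0 (fun α i => by
    simp only [dS_mon, dT_mon, Derivation.map_smul, smul_smul, zero_smul, add_zero, mul_comm]) x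
  simpa using this

lemma dT_dT (r s : ℕ) (x : BB F) : dT r (dT s x) = dT s (dT r x) := by
  have := der_ext_comm (dT r) (dT s) 0 0 (fun α i => by
    by_cases h : r = s
    · subst h; simp
    · have h' : s ≠ r := fun h' => h h'.symm
      simp only [dT_mon, Derivation.map_smul, smul_smul, zero_smul, add_zero]
      have e1 : (i - es s) r = i r := by simp [h]
      have e2 : (i - es r) s = i s := by simp [h']
      rw [e1, e2, mul_comm, tsub_right_comm]) x
  simpa using this

end Ring
end KH2
end

noncomputable section
namespace KH2
set_option linter.unusedSectionVars false
set_option linter.unusedSimpArgs false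

section Idx
variable (ℓ : ℕ → ℕ)

def logS : Finset ℕ := jSet ℓ 1 3 ∪ iSet ℓ 4 5
def polS : Finset ℕ := iSet ℓ 6 6 ∪ barSet ℓ (iSet ℓ 4 6)

lemma iot_succ (k : ℕ) : iot ℓ (k + 1) = iot ℓ k + ℓ (k + 1) := by
  simp only [iot]
  rw [Finset.sum_Icc_succ_top (by omega)]

lemma iot_zero : iot ℓ 0 = 0 := by simp [iot]

lemma iot_mono : iot ℓ 0 = 0 ∧ iot ℓ 1 = ℓ 1 ∧ iot ℓ 1 ≤ iot ℓ 2 ∧ iot ℓ 2 ≤ iot ℓ 3 ∧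
    iot ℓ 3 ≤ iot ℓ 4 ∧ iot ℓ 4 ≤ iot ℓ 5 ∧ iot ℓ 5 ≤ iot ℓ 6 := by
  have h := iot_succ ℓ
  have := h 0; have := h 1; have := h 2; have := h 3; have := h 4; have := h 5
  have := iot_zero ℓ
  simp only [zero_add, Nat.reduceAdd] at *
  refine ⟨by omega, by omega, by omega, by omega, by omega, by omega, by omega⟩

lemma mem_iSet (i j p : ℕ) : p ∈ iSet ℓ i j ↔ iot ℓ (i - 1) + 1 ≤ p ∧ p ≤ iot ℓ j := by
  simp [iSet]

lemma mem_barSet (i j r : ℕ) (hj : iot ℓ j ≤ iot ℓ 6) : r ∈ barSet ℓ (iSet ℓ i j) ↔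
    iot ℓ 6 + iot ℓ (i - 1) + 1 ≤ r ∧ r ≤ iot ℓ 6 + iot ℓ j := by
  simp only [barSet, Finset.mem_image, mem_iSet, bar]
  constructor
  · rintro ⟨a, ha, rfl⟩
    rw [if_pos (by omega)]; omega
  · intro h
    exact ⟨r - iot ℓ 6, by omega, by rw [if_pos (by omega)]; omega⟩

lemma bar_of_le {q : ℕ} (h : q ≤ iot ℓ 6) : bar ℓ q = q + iot ℓ 6 := by simp [bar, h]

lemma mem_logS (r : ℕ) : r ∈ logS ℓ ↔
    (1 ≤ r ∧ r ≤ iot ℓ 5) ∨ (iot ℓ 6 + 1 ≤ r ∧ r ≤ iot ℓ 6 + iot ℓ 3) := by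
  have := iot_mono ℓ
  simp only [logS, jSet, Finset.mem_union]
  rw [mem_barSet ℓ _ _ _ (by omega)]
  simp only [mem_iSet, Nat.reduceSub]
  omega

lemma mem_polS (r : ℕ) : r ∈ polS ℓ ↔
    (iot ℓ 5 + 1 ≤ r ∧ r ≤ iot ℓ 6) ∨ (iot ℓ 6 + iot ℓ 3 + 1 ≤ r ∧ r ≤ 2 * iot ℓ 6) := by
  have := iot_mono ℓ
  simp only [polS, Finset.mem_union]
  rw [mem_barSet ℓ _ _ _ (by omega)]
  simp only [mem_iSet, Nat.reduceSub]
  omega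

/-- The indices `r` for which `t_r` exists. -/
def allow (j0 : Bool) (r : ℕ) : Prop :=
  (r = 0 ∧ j0 = true) ∨ (iot ℓ 2 + 1 ≤ r ∧ r ≤ iot ℓ 3) ∨ (iot ℓ 4 + 1 ≤ r ∧ r ≤ iot ℓ 6) ∨
    (iot ℓ 6 + iot ℓ 1 + 1 ≤ r ∧ r ≤ 2 * iot ℓ 6)

lemma mem_jIdx (j0 : Bool) (i : ℕ → ℕ) :
    i ∈ jIdx ℓ j0 ↔ ∀ r, ¬ allow ℓ j0 r → i r = 0 := by
  have := iot_mono ℓ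
  have key : ∀ p, (p ∈ iSet ℓ 1 2 ∪ iSet ℓ 4 4 ∪ barSet ℓ (iSet ℓ 1 1)) ↔
      (1 ≤ p ∧ p ≤ iot ℓ 2) ∨ (iot ℓ 3 + 1 ≤ p ∧ p ≤ iot ℓ 4) ∨
      (iot ℓ 6 + 1 ≤ p ∧ p ≤ iot ℓ 6 + iot ℓ 1) := by
    intro p
    simp only [Finset.mem_union]
    rw [mem_barSet ℓ _ _ _ (by omega)]
    simp only [mem_iSet, Nat.reduceSub]
    omega
  simp only [jIdx, Set.mem_ofPred_eq, key]
  constructor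
  · rintro ⟨h1, h2⟩ r hr
    by_cases h : r = 0
    · subst h
      apply h1
      by_contra hj
      exact hr (Or.inl ⟨rfl, by simpa using hj⟩)
    · apply h2 r (by omega)
      simp only [allow] at hr
      omega
  · intro h
    refine ⟨fun hj => h 0 ?_, fun p hp hp' => h p ?_⟩
    · simp [allow, hj]
    · simp only [allow]; omega

lemma jIdx_zero (j0 : Bool) : (0 : ℕ → ℕ) ∈ jIdx ℓ j0 := by simp [mem_jIdx]

lemma jIdx_add {j0 : Bool} {i j : ℕ → ℕ} (hi : i ∈ jIdx ℓ j0) (hj : j ∈ jIdx ℓ j0) :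
    i + j ∈ jIdx ℓ j0 := by
  rw [mem_jIdx] at *
  intro r hr; simp [hi r hr, hj r hr]

lemma jIdx_sub {j0 : Bool} {i : ℕ → ℕ} (hi : i ∈ jIdx ℓ j0) (j : ℕ → ℕ) :
    i - j ∈ jIdx ℓ j0 := by
  rw [mem_jIdx] at *
  intro r hr; simp [hi r hr]

lemma jIdx_es {j0 : Bool} {r : ℕ} (h : allow ℓ j0 r) : es r ∈ jIdx ℓ j0 := by
  rw [mem_jIdx]
  intro s hs
  have : s ≠ r := by rintro rfl; exact hs h
  simp [this]

end Idx

/-- The hypotheses of the theorem, bundled. -/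
structure Hyp {F : Type*} [Field F] (ℓ : ℕ → ℕ) (Γ : AddSubgroup (ℕ → F)) (j0 : Bool) : Prop where
  h1 : ∀ p ∈ logS ℓ, (Pi.single p (1 : F) : ℕ → F) ∈ Γ
  h2 : ∀ α ∈ Γ, ∀ p ∈ polS ℓ, α p = 0
  hn : 0 < iot ℓ 6
  hz : j0 = false → (Pi.single 0 (1 : F) : ℕ → F) ∈ Γ

section Phi
variable {F : Type*} [Field F] {ℓ : ℕ → ℕ} {Γ : AddSubgroup (ℕ → F)} {j0 : Bool}

variable (F ℓ Γ j0) in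
def Phi : CA F ℓ Γ j0 →ₗ[F] BB F :=
  Finsupp.linearCombination F (fun a => mon a.1.1 a.2.1)

lemma X_of_mem {α : ℕ → F} {i : ℕ → ℕ} (hα : α ∈ Γ) (hi : i ∈ jIdx ℓ j0) :
    X F ℓ Γ j0 α i = Finsupp.single (⟨α, hα⟩, ⟨i, hi⟩) 1 := by
  rw [X, dif_pos ⟨hα, hi⟩]

lemma Phi_X {α : ℕ → F} {i : ℕ → ℕ} (hα : α ∈ Γ) (hi : i ∈ jIdx ℓ j0) :
    Phi F ℓ Γ j0 (X F ℓ Γ j0 α i) = mon α i := by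
  rw [X_of_mem hα hi, Phi, Finsupp.linearCombination_single, one_smul]

lemma Phi_eq_sum (u : CA F ℓ Γ j0) :
    Phi F ℓ Γ j0 u = u.sum fun a c => c • mon a.1.1 a.2.1 := rfl

lemma Phi_inj : Function.Injective (Phi F ℓ Γ j0) := by
  have h : ∀ u, cf F (Phi F ℓ Γ j0 u) =
      Finsupp.mapDomain (fun a : ↥Γ × ↥(jIdx ℓ j0) => ((a.1.1, a.2.1) : (ℕ → F) × (ℕ → ℕ))) u := by
    intro u
    rw [Phi_eq_sum, map_finsuppSum, Finsupp.mapDomain]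
    refine Finsupp.sum_congr fun a _ => ?_
    rw [map_smul, cf_mon]; simp
  have hinj : Function.Injective
      (fun a : ↥Γ × ↥(jIdx ℓ j0) => ((a.1.1, a.2.1) : (ℕ → F) × (ℕ → ℕ))) := by
    rintro ⟨⟨a, _⟩, ⟨b, _⟩⟩ ⟨⟨c, _⟩, ⟨d, _⟩⟩ h
    simp only [Prod.mk.injEq] at h
    obtain ⟨rfl, rfl⟩ := h
    rfl
  intro u v huv
  have := congrArg (cf F) huv
  rw [h, h] at this
  exact Finsupp.mapDomain_injective hinj this

lemma Phi_mul (u v : CA F ℓ Γ j0) :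
    Phi F ℓ Γ j0 (mulA F ℓ Γ j0 u v) = Phi F ℓ Γ j0 u * Phi F ℓ Γ j0 v := by
  rw [mulA, map_finsuppSum, Phi_eq_sum u, Finsupp.sum_mul]
  refine Finsupp.sum_congr fun a _ => ?_
  rw [map_finsuppSum, Phi_eq_sum v, Finsupp.mul_sum]
  refine Finsupp.sum_congr fun b _ => ?_
  rw [map_smul, Phi_X (add_mem a.1.2 b.1.2) (jIdx_add ℓ a.2.2 b.2.2), ← mon_mul]
  simp only [smul_mul_assoc, mul_smul_comm, smul_smul]
  rw [mul_comm]

lemma Phi_pstar (p : ℕ) (u : CA F ℓ Γ j0) :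
    Phi F ℓ Γ j0 (pstar F ℓ Γ j0 p u) = dS p (Phi F ℓ Γ j0 u) := by
  rw [pstar, map_finsuppSum, Phi_eq_sum u, map_finsuppSum]
  refine Finsupp.sum_congr fun a _ => ?_
  rw [map_smul, Derivation.map_smul, dS_mon, Phi, Finsupp.linearCombination_single, one_smul,
    smul_smul]

lemma Phi_pt (p : ℕ) (u : CA F ℓ Γ j0) :
    Phi F ℓ Γ j0 (pt F ℓ Γ j0 p u) = dT p (Phi F ℓ Γ j0 u) := by
  rw [pt, map_finsuppSum, Phi_eq_sum u, map_finsuppSum]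
  refine Finsupp.sum_congr fun a _ => ?_
  rw [map_smul, Derivation.map_smul, dT_mon, Phi_X a.1.2 (jIdx_sub ℓ a.2.2 _), smul_smul]

lemma dS_Phi_pol (H : Hyp ℓ Γ j0) {p : ℕ} (hp : p ∈ polS ℓ) (u : CA F ℓ Γ j0) :
    dS p (Phi F ℓ Γ j0 u) = 0 := by
  rw [Phi_eq_sum u, map_finsuppSum]
  refine Finset.sum_eq_zero fun a _ => ?_
  show dS p (_ • _) = 0
  rw [Derivation.map_smul, dS_mon, H.h2 _ a.1.2 p hp]; simp

variable (F ℓ) in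
/-- The exponent of `z_r`-normalisation. -/
def ax (r : ℕ) : ℕ → F := if r ∈ logS ℓ then -Pi.single r 1 else 0

variable (F ℓ) in
/-- The derivation `∂/∂z_r`. -/
def dl (r : ℕ) : Derivation F (BB F) (BB F) :=
  if r ∈ logS ℓ then mon (-Pi.single r (1 : F)) 0 • (dS r + dT r) else dT r

variable (F ℓ) in
def EE : Derivation F (BB F) (BB F) :=
  (∑ p ∈ logS ℓ, dS p) + ∑ p ∈ polS ℓ, mon (0 : ℕ → F) (es p) • dT p

variable (F) in
def d00 : Derivation F (BB F) (BB F) := dS 0 + dT 0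

variable (F ℓ) in
def brB (u v : BB F) : BB F :=
  cb (iSet ℓ 1 6) (fun q => dl F ℓ q) (fun q => dl F ℓ (q + iot ℓ 6)) (d00 F) (EE F ℓ) u v

lemma der_sum (S : Finset ℕ) (f : ℕ → Derivation F (BB F) (BB F)) (x : BB F) :
    (∑ p ∈ S, f p) x = ∑ p ∈ S, f p x := by
  classical
  induction S using Finset.induction_on with
  | empty => simp
  | insert a s ha ih => rw [Finset.sum_insert ha, Finset.sum_insert ha, ← ih, Derivation.add_apply]

lemma Phi_dd_log (p : ℕ) (u : CA F ℓ Γ j0) :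
    Phi F ℓ Γ j0 (dd F ℓ Γ j0 p u) = (dS p + dT p : Derivation F (BB F) (BB F)) (Phi F ℓ Γ j0 u) := by
  rw [dd, map_add, Phi_pstar, Phi_pt, Derivation.add_apply]

lemma ax_dl (H : Hyp ℓ Γ j0) {r : ℕ} (hr : r ∈ logS ℓ ∨ r ∈ polS ℓ) (u : CA F ℓ Γ j0) :
    dl F ℓ r (Phi F ℓ Γ j0 u) = mon (ax F ℓ r) 0 * Phi F ℓ Γ j0 (dd F ℓ Γ j0 r u) := by
  rw [Phi_dd_log, dl, ax]
  split_ifs with h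
  · rw [Derivation.smul_apply, smul_eq_mul]
  · have hp : r ∈ polS ℓ := by tauto
    rw [Derivation.add_apply, dS_Phi_pol H hp, zero_add, mon_zero, one_mul]

lemma sgm_eq {q : ℕ} (hq : q ∈ iSet ℓ 1 6) :
    sgm F ℓ q = ax F ℓ q + ax F ℓ (q + iot ℓ 6) := by
  have := iot_mono ℓ
  rw [mem_iSet] at hq
  simp only [sgm, ax, mem_logS, mem_iSet, Nat.reduceSub] at *
  rw [if_pos hq.2]
  by_cases h3 : q ≤ iot ℓ 3
  · rw [if_pos (by omega), if_pos (by omega), if_pos (by omega)]; rw [sub_eq_add_neg]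
  · rw [if_neg (by omega)]
    by_cases h5 : q ≤ iot ℓ 5
    · rw [if_pos (by omega), if_pos (by omega), if_neg (by omega), add_zero]
    · rw [if_neg (by omega), if_neg (by omega), if_neg (by omega), add_zero]

lemma ax_mem (H : Hyp ℓ Γ j0) (r : ℕ) : ax F ℓ r ∈ Γ := by
  rw [ax]; split_ifs with h
  · exact neg_mem (H.h1 r h)
  · exact zero_mem _

lemma pol_allow {r : ℕ} (h : r ∈ polS ℓ) : allow ℓ j0 r := by
  have := iot_mono ℓ
  rw [mem_polS] at h
  simp only [allow]; omega

lemma log_or_pol {r : ℕ} (h1 : 1 ≤ r) (h2 : r ≤ 2 * iot ℓ 6) : r ∈ logS ℓ ∨ r ∈ polS ℓ := by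
  have := iot_mono ℓ
  rw [mem_polS, mem_logS]; omega

lemma log_not_pol {r : ℕ} (h1 : r ∈ logS ℓ) : r ∉ polS ℓ := by
  have := iot_mono ℓ
  rw [mem_logS] at h1
  rw [mem_polS]; omega

lemma pol_not_log {r : ℕ} (h1 : r ∈ polS ℓ) : r ∉ logS ℓ := fun h => log_not_pol h h1

lemma Phi_Dop (u : CA F ℓ Γ j0) :
    Phi F ℓ Γ j0 (Dop F ℓ Γ j0 u) = EE F ℓ (Phi F ℓ Γ j0 u) := by
  rw [Dop, map_add, map_sum, map_sum, EE, Derivation.add_apply, der_sum, der_sum]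
  congr 1
  · exact Finset.sum_congr rfl fun p _ => Phi_pstar p u
  · refine Finset.sum_congr rfl fun p hp => ?_
    rw [Phi_mul, Phi_pt, Derivation.smul_apply, smul_eq_mul,
      Phi_X (zero_mem _) (jIdx_es ℓ (pol_allow hp))]

lemma Phi_brk (H : Hyp ℓ Γ j0) (u v : CA F ℓ Γ j0) :
    Phi F ℓ Γ j0 (brk F ℓ Γ j0 u v) = brB F ℓ (Phi F ℓ Γ j0 u) (Phi F ℓ Γ j0 v) := by
  have h2 : ∀ u : CA F ℓ Γ j0, Phi F ℓ Γ j0 ((2 : F) • u - Dop F ℓ Γ j0 u) =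
      2 * Phi F ℓ Γ j0 u - EE F ℓ (Phi F ℓ Γ j0 u) := by
    intro u
    rw [map_sub, Phi_Dop, map_smul, two_smul, two_mul]
  rw [brk, brB, cb, map_sub, map_add, Phi_mul, Phi_mul, h2, h2, Phi_dd_log, Phi_dd_log, map_sum,
    pb, d00]
  congr 2
  refine Finset.sum_congr rfl fun q hq => ?_
  have hq' := (mem_iSet ℓ 1 6 q).1 hq
  rw [Phi_mul, map_sub, Phi_mul, Phi_mul, Phi_X _ (jIdx_zero ℓ j0), sgm_eq hq,
    bar_of_le ℓ hq'.2]
  · have e : mon (ax F ℓ q + ax F ℓ (q + iot ℓ 6)) 0 =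
        mon (ax F ℓ q) 0 * mon (ax F ℓ (q + iot ℓ 6)) 0 := by rw [mon_mul, add_zero]
    have l1 : q ∈ logS ℓ ∨ q ∈ polS ℓ := log_or_pol (by omega) (by omega)
    have l2 : (q + iot ℓ 6) ∈ logS ℓ ∨ (q + iot ℓ 6) ∈ polS ℓ :=
      log_or_pol (by omega) (by omega)
    rw [ax_dl H l1, ax_dl H l1, ax_dl H l2, ax_dl H l2, e]
    ring
  · rw [sgm_eq hq]
    exact add_mem (ax_mem H _) (ax_mem H _)

end Phi
end KH2
end

noncomputable section
namespace KH2
set_option linter.unusedSectionVars false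
set_option linter.unusedSimpArgs false

section Rel
variable {F : Type*} [Field F] {ℓ : ℕ → ℕ} {Γ : AddSubgroup (ℕ → F)} {j0 : Bool}

variable (ℓ) in
/-- The degree of a monomial. -/
def deg (β : ℕ → F) (j : ℕ → ℕ) : F := ∑ p ∈ logS ℓ, β p + ∑ p ∈ polS ℓ, (j p : F)

lemma es_add_sub {j : ℕ → ℕ} {r : ℕ} (h : j r ≠ 0) : es r + (j - es r) = j := by
  funext k
  by_cases hk : k = r
  · subst hk; simp; omega
  · simp [hk]

lemma t_dT (r : ℕ) (β : ℕ → F) (j : ℕ → ℕ) :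
    mon (0 : ℕ → F) (es r) * dT r (mon β j) = (j r : F) • mon β j := by
  rw [dT_mon, mul_smul_comm, mon_mul, zero_add]
  by_cases h : j r = 0
  · simp [h]
  · rw [es_add_sub h]

lemma EE_mon (β : ℕ → F) (j : ℕ → ℕ) : EE F ℓ (mon β j) = deg ℓ β j • mon β j := by
  rw [EE, Derivation.add_apply, der_sum, der_sum, deg, add_smul, Finset.sum_smul, Finset.sum_smul]
  congr 1
  · exact Finset.sum_congr rfl fun p _ => dS_mon p _ _
  · refine Finset.sum_congr rfl fun p _ => ?_
    rw [Derivation.smul_apply, smul_eq_mul, t_dT]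

lemma d00_mon (β : ℕ → F) (j : ℕ → ℕ) :
    d00 F (mon β j) = β 0 • mon β j + (j 0 : F) • mon β (j - es 0) := by
  rw [d00, Derivation.add_apply, dS_mon, dT_mon]

lemma dl_log {r : ℕ} (h : r ∈ logS ℓ) (x : BB F) :
    dl F ℓ r x = mon (-Pi.single r (1 : F)) 0 * (dS r x + dT r x) := by
  rw [dl, if_pos h, Derivation.smul_apply, Derivation.add_apply, smul_eq_mul]

lemma dl_nlog {r : ℕ} (h : r ∉ logS ℓ) (x : BB F) : dl F ℓ r x = dT r x := by
  rw [dl, if_neg h]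

lemma dl_log_mon {r : ℕ} (h : r ∈ logS ℓ) (β : ℕ → F) (j : ℕ → ℕ) :
    dl F ℓ r (mon β j) = β r • mon (β - Pi.single r 1) j
      + (j r : F) • mon (β - Pi.single r 1) (j - es r) := by
  rw [dl_log h, dS_mon, dT_mon, mul_add, mul_smul_comm, mul_smul_comm, mon_mul, mon_mul]
  rw [zero_add, zero_add, neg_add_eq_sub]

lemma dl_mon_zero {r : ℕ} {β : ℕ → F} {j : ℕ → ℕ} (h1 : β r = 0) (h2 : j r = 0) :
    dl F ℓ r (mon β j) = 0 := by
  by_cases h : r ∈ logS ℓ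
  · rw [dl_log_mon h, h1, h2]; simp
  · rw [dl_nlog h, dT_mon, h2]; simp

lemma dS_dl {r s : ℕ} (h : s ≠ r) (x : BB F) : dS s (dl F ℓ r x) = dl F ℓ r (dS s x) := by
  by_cases hr : r ∈ logS ℓ
  · rw [dl_log hr, dl_log hr, Derivation.leibniz, dS_mon, map_add, dS_dS, dS_dT]
    simp [h]
  · rw [dl_nlog hr, dl_nlog hr, dS_dT]

lemma dT_dl {r s : ℕ} (x : BB F) : dT s (dl F ℓ r x) = dl F ℓ r (dT s x) := by
  by_cases hr : r ∈ logS ℓ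
  · rw [dl_log hr, dl_log hr, Derivation.leibniz, dT_mon, map_add, dT_dT, dS_dT]
    simp
  · rw [dl_nlog hr, dl_nlog hr, dT_dT]

lemma dl_dl (r s : ℕ) (x : BB F) : dl F ℓ r (dl F ℓ s x) = dl F ℓ s (dl F ℓ r x) := by
  by_cases h : r = s
  · rw [h]
  by_cases hr : r ∈ logS ℓ
  · rw [dl_log hr, dl_log hr, dS_dl h, dT_dl, Derivation.leibniz, map_add,
      dl_mon_zero (r := s) (by simp [Ne.symm h]) (by simp)]
    simp
  · rw [dl_nlog hr, dl_nlog hr, dT_dl]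

lemma d00_dl {r : ℕ} (h : 1 ≤ r) (x : BB F) : d00 F (dl F ℓ r x) = dl F ℓ r (d00 F x) := by
  rw [d00, Derivation.add_apply, Derivation.add_apply, dS_dl (by omega), dT_dl, map_add]

lemma deg_sub_log {r : ℕ} (h : r ∈ logS ℓ) (β : ℕ → F) (j : ℕ → ℕ) :
    deg ℓ (β - Pi.single r 1) j = deg ℓ β j - 1 := by
  simp only [deg, Pi.sub_apply, Finset.sum_sub_distrib]
  rw [Finset.sum_pi_single', if_pos h]; ring

lemma deg_sub_es {r : ℕ} (h : r ∉ polS ℓ) (β : ℕ → F) (j : ℕ → ℕ) :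
    deg ℓ β (j - es r) = deg ℓ β j := by
  simp only [deg]
  congr 1
  refine Finset.sum_congr rfl fun p hp => ?_
  have : p ≠ r := by rintro rfl; exact h hp
  simp [this]

lemma deg_sub_pol {r : ℕ} (h : r ∈ polS ℓ) (β : ℕ → F) (j : ℕ → ℕ) (hj : j r ≠ 0) :
    deg ℓ β (j - es r) = deg ℓ β j - 1 := by
  simp only [deg]
  rw [add_sub_assoc]
  congr 1
  rw [← Finset.add_sum_erase _ _ h, ← Finset.add_sum_erase (polS ℓ) (fun p => (j p : F)) h]
  have : ∑ p ∈ (polS ℓ).erase r, ((j - es r) p : F) = ∑ p ∈ (polS ℓ).erase r, (j p : F) := by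
    refine Finset.sum_congr rfl fun p hp => ?_
    have : p ≠ r := Finset.ne_of_mem_erase hp
    simp [this]
  rw [this]
  obtain ⟨k, hk⟩ := Nat.exists_eq_succ_of_ne_zero hj
  simp [hk]; ring

lemma EE_dl {r : ℕ} (h : r ∈ logS ℓ ∨ r ∈ polS ℓ) (x : BB F) :
    EE F ℓ (dl F ℓ r x) = dl F ℓ r (EE F ℓ x) - dl F ℓ r x := by
  have := der_ext_comm (EE F ℓ) (dl F ℓ r) (dl F ℓ r) (-1) (fun α i => by
    rw [EE_mon, Derivation.map_smul]
    rcases h with h | h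
    · rw [dl_log_mon h, map_add, Derivation.map_smul, Derivation.map_smul, EE_mon, EE_mon,
        deg_sub_es (log_not_pol h), deg_sub_log h]
      module
    · rw [dl_nlog (pol_not_log h), dT_mon, Derivation.map_smul, EE_mon]
      by_cases hi : i r = 0
      · simp [hi]
      · rw [deg_sub_pol h _ _ hi]; module) x
  rw [this]; simp [sub_eq_add_neg]

lemma zero_not_mem : 0 ∉ logS ℓ ∧ 0 ∉ polS ℓ := by
  rw [mem_logS, mem_polS]; omega

lemma EE_d00 (x : BB F) : EE F ℓ (d00 F x) = d00 F (EE F ℓ x) := by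
  have := der_ext_comm (EE F ℓ) (d00 F) 0 0 (fun α i => by
    rw [EE_mon, Derivation.map_smul, d00_mon, map_add, Derivation.map_smul, Derivation.map_smul,
      EE_mon, EE_mon, deg_sub_es zero_not_mem.2]
    module) x
  simpa using this

lemma one_le_of_iSet {q : ℕ} (hq : q ∈ iSet ℓ 1 6) : 1 ≤ q ∧ q ≤ iot ℓ 6 := by
  rw [mem_iSet] at hq; omega

lemma brB_jac [CharZero F] (hn : 0 < iot ℓ 6) (u v w : BB F) :
    brB F ℓ (brB F ℓ u v) w + brB F ℓ (brB F ℓ v w) u + brB F ℓ (brB F ℓ w u) v = 0 := by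
  · have hd' : ∀ a b : BB F, brB F ℓ a b = cb (iSet ℓ 1 6) (fun q => dl F ℓ (max q 1))
        (fun q => dl F ℓ (q + iot ℓ 6)) (d00 F) (EE F ℓ) a b := fun a b => by
      have hp : pb (iSet ℓ 1 6) (fun q => dl F ℓ q) (fun q => dl F ℓ (q + iot ℓ 6)) a b =
          pb (iSet ℓ 1 6) (fun q => dl F ℓ (max q 1)) (fun q => dl F ℓ (q + iot ℓ 6)) a b := by
        refine Finset.sum_congr rfl fun q hq => ?_
        have := max_eq_left (one_le_of_iSet hq).1
        simp only [this]
      rw [brB, cb, hp, cb]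
    simp only [hd']
    refine cb_jac _ _ _ _ _ (fun _ _ _ => dl_dl _ _ _) (fun _ _ _ => dl_dl _ _ _)
      (fun _ _ _ => dl_dl _ _ _) (fun _ _ => d00_dl (by simp) _) (fun _ _ => d00_dl (by omega) _)
      EE_d00 (fun q hq x => EE_dl ?_ x) (fun q hq x => EE_dl ?_ x) u v w
    · have := one_le_of_iSet hq; exact log_or_pol (by omega) (by omega)
    · have := one_le_of_iSet hq; exact log_or_pol (by omega) (by omega)

lemma brB_skew [CharZero F] (u v : BB F) : brB F ℓ v u = - brB F ℓ u v := by
  simp only [brB, cb]; rw [pb_skew]; ring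

lemma brB_add (u u' v : BB F) : brB F ℓ (u + u') v = brB F ℓ u v + brB F ℓ u' v := by
  simp only [brB, cb, pb, map_add]
  have : ∀ a b c d e f a' : BB F, a' = a + b → (a' + c - d = a + e - f + (b + (c - e) - (d - f))) := by
    intros; subst_vars; ring
  rw [this _ _ _ _ _ _ _ _]
  rotate_left 5
  · rw [← Finset.sum_add_distrib]
    refine Finset.sum_congr rfl fun q _ => ?_
    rw [show ∀ a b c d x y : BB F, (a + b) * x - (c + d) * y = (a * x - c * y) + (b * x - d * y)
      from by intros; ring]
  · ring

lemma brB_smul (c : F) (u v : BB F) : brB F ℓ (c • u) v = c • brB F ℓ u v := by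
  simp only [brB, cb, pb, Derivation.map_smul, smul_sub, smul_add, Finset.smul_sum,
    smul_mul_assoc, mul_smul_comm, sub_mul]

end Rel

section Coc
variable {F : Type*} [Field F] [CharZero F] {ℓ : ℕ → ℕ} {Γ : AddSubgroup (ℕ → F)} {j0 : Bool}

lemma brk_skew (H : Hyp ℓ Γ j0) (u v : CA F ℓ Γ j0) : brk F ℓ Γ j0 v u = - brk F ℓ Γ j0 u v := by
  apply Phi_inj
  rw [map_neg, Phi_brk H, Phi_brk H, brB_skew]

lemma brk_jac (H : Hyp ℓ Γ j0) (u v w : CA F ℓ Γ j0) :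
    brk F ℓ Γ j0 (brk F ℓ Γ j0 u v) w + brk F ℓ Γ j0 (brk F ℓ Γ j0 v w) u
      + brk F ℓ Γ j0 (brk F ℓ Γ j0 w u) v = 0 := by
  apply Phi_inj
  simp only [map_add, Phi_brk H, map_zero]
  exact brB_jac H.hn _ _ _

lemma brk_add_left (H : Hyp ℓ Γ j0) (u u' v : CA F ℓ Γ j0) :
    brk F ℓ Γ j0 (u + u') v = brk F ℓ Γ j0 u v + brk F ℓ Γ j0 u' v := by
  apply Phi_inj
  simp only [map_add, Phi_brk H, brB_add]

lemma brk_smul_left (H : Hyp ℓ Γ j0) (c : F) (u v : CA F ℓ Γ j0) :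
    brk F ℓ Γ j0 (c • u) v = c • brk F ℓ Γ j0 u v := by
  apply Phi_inj
  simp only [map_smul, Phi_brk H, brB_smul]

/-- The bracket as a bilinear map. -/
def brL (H : Hyp ℓ Γ j0) : CA F ℓ Γ j0 →ₗ[F] CA F ℓ Γ j0 →ₗ[F] CA F ℓ Γ j0 :=
  LinearMap.mk₂ F (brk F ℓ Γ j0) (brk_add_left H) (brk_smul_left H)
    (fun u v v' => by
      rw [brk_skew H (v + v') u, brk_add_left H, brk_skew H v u, brk_skew H v' u]; abel)
    (fun c u v => by
      rw [brk_skew H (c • v) u, brk_smul_left H, brk_skew H v u, smul_neg])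

lemma brL_apply (H : Hyp ℓ Γ j0) (u v : CA F ℓ Γ j0) : brL H u v = brk F ℓ Γ j0 u v := rfl

/-- 2-cocycles. -/
structure Coc (ψ : CA F ℓ Γ j0 →ₗ[F] CA F ℓ Γ j0 →ₗ[F] F) : Prop where
  skew : ∀ u v, ψ u v = -ψ v u
  jac : ∀ u v w, ψ (brk F ℓ Γ j0 u v) w + ψ (brk F ℓ Γ j0 v w) u + ψ (brk F ℓ Γ j0 w u) v = 0

/-- invariance identity -/
lemma Coc.inv (H : Hyp ℓ Γ j0) {ψ : CA F ℓ Γ j0 →ₗ[F] CA F ℓ Γ j0 →ₗ[F] F} (C : Coc ψ)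
    (g w z : CA F ℓ Γ j0) :
    ψ g (brk F ℓ Γ j0 w z) = ψ (brk F ℓ Γ j0 g w) z + ψ w (brk F ℓ Γ j0 g z) := by
  have h := C.jac g w z
  rw [brk_skew H g z, map_neg, LinearMap.neg_apply] at h
  rw [C.skew g, C.skew w]
  linear_combination -h

lemma Coc.sub (H : Hyp ℓ Γ j0) {ψ : CA F ℓ Γ j0 →ₗ[F] CA F ℓ Γ j0 →ₗ[F] F} (C : Coc ψ)
    (f : CA F ℓ Γ j0 →ₗ[F] F) : Coc (ψ - (brL H).compr₂ f) where
  skew u v := by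
    simp only [LinearMap.sub_apply, LinearMap.compr₂_apply, brL_apply]
    rw [C.skew, brk_skew H v u, map_neg]; ring
  jac u v w := by
    simp only [LinearMap.sub_apply, LinearMap.compr₂_apply, brL_apply]
    have h := congrArg f (brk_jac H u v w)
    simp only [map_add, map_zero] at h
    linear_combination C.jac u v w - h

lemma exists_of_sub (H : Hyp ℓ Γ j0) {ψ : CA F ℓ Γ j0 →ₗ[F] CA F ℓ Γ j0 →ₗ[F] F}
    (f : CA F ℓ Γ j0 →ₗ[F] F) (h : ψ - (brL H).compr₂ f = 0) :
    ∃ f : CA F ℓ Γ j0 →ₗ[F] F, ∀ u v : CA F ℓ Γ j0, ψ u v = f (brk F ℓ Γ j0 u v) := by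
  refine ⟨f, fun u v => ?_⟩
  have := LinearMap.congr_fun (LinearMap.congr_fun h u) v
  simp only [LinearMap.sub_apply, LinearMap.compr₂_apply, brL_apply, LinearMap.zero_apply] at this
  linear_combination this

lemma lin_ext {M : Type*} [AddCommMonoid M] [Module F M] {φ : CA F ℓ Γ j0 →ₗ[F] M}
    (h : ∀ β ∈ Γ, ∀ j ∈ jIdx ℓ j0, φ (X F ℓ Γ j0 β j) = 0) : φ = 0 := by
  refine Finsupp.lhom_ext' fun a => LinearMap.ext_ring ?_
  have := h a.1.1 a.1.2 a.2.1 a.2.2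
  rw [X_of_mem a.1.2 a.2.2] at this
  simpa using this

/-- linear functional with prescribed values on monomials -/
def mkf (G : (ℕ → F) → (ℕ → ℕ) → F) : CA F ℓ Γ j0 →ₗ[F] F :=
  Finsupp.linearCombination F (fun a => G a.1.1 a.2.1)

lemma mkf_X (G : (ℕ → F) → (ℕ → ℕ) → F) {β : ℕ → F} {j : ℕ → ℕ} (hβ : β ∈ Γ)
    (hj : j ∈ jIdx ℓ j0) : mkf G (X F ℓ Γ j0 β j) = G β j := by
  rw [X_of_mem hβ hj, mkf, Finsupp.linearCombination_single, one_smul]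

end Coc
end KH2
end

noncomputable section
namespace KH2
set_option linter.unusedSectionVars false
set_option linter.unusedSimpArgs false

section Gen
variable {F : Type*} [Field F] [CharZero F] {ℓ : ℕ → ℕ} {Γ : AddSubgroup (ℕ → F)} {j0 : Bool}

lemma add_es_sub (j : ℕ → ℕ) (r : ℕ) : j + es r - es r = j := by
  funext k; simp

lemma cast_ne (n : ℕ) : ((n : F) + 1) ≠ 0 := Nat.cast_add_one_ne_zero n

/-- recursive solution -/
def solG (φ : CA F ℓ Γ j0 →ₗ[F] F) (r : ℕ) : ℕ → (ℕ → F) → (ℕ → ℕ) → F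
  | 0, β, j => φ (X F ℓ Γ j0 β j) / β r
  | n + 1, β, j => (φ (X F ℓ Γ j0 β j) - (n + 1) * solG φ r n β (j - es r)) / β r

lemma solve {r : ℕ} {s : ℕ → F} (hs : s ∈ Γ) (φ : CA F ℓ Γ j0 →ₗ[F] F)
    (hφ : ∀ β ∈ Γ, ∀ j ∈ jIdx ℓ j0, β r = 0 → j r = 0 → φ (X F ℓ Γ j0 β j) = 0) :
    ∃ f : CA F ℓ Γ j0 →ₗ[F] F, ∀ β ∈ Γ, ∀ j ∈ jIdx ℓ j0,
      β r * f (X F ℓ Γ j0 (β + s) j) + (j r : F) * f (X F ℓ Γ j0 (β + s) (j - es r))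
        = φ (X F ℓ Γ j0 β j) := by
  classical
  refine ⟨mkf fun γ j => if (γ - s) r = 0 then φ (X F ℓ Γ j0 (γ - s) (j + es r)) / ((j r : F) + 1)
    else solG φ r (j r) (γ - s) j, fun β hβ j hj => ?_⟩
  rw [mkf_X _ (add_mem hβ hs) hj, mkf_X _ (add_mem hβ hs) (jIdx_sub ℓ hj _), add_sub_cancel_right]
  by_cases h : β r = 0
  · simp only [h, if_true]
    by_cases h' : j r = 0
    · rw [hφ β hβ j hj h h', h']; simp
    · obtain ⟨k, hk⟩ := Nat.exists_eq_succ_of_ne_zero h'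
      rw [add_comm (j - es r), es_add_sub h']
      have := cast_ne (F := F) k
      simp [hk]; field_simp
  · simp only [h, if_false]
    cases hk : j r with
    | zero => simp [solG]; field_simp
    | succ k =>
      simp [solG, hk]; field_simp; ring

lemma surj {r : ℕ} {s : ℕ → F} (hs : s ∈ Γ) (hr : allow ℓ j0 r) (χ : CA F ℓ Γ j0 →ₗ[F] F)
    (h : ∀ β ∈ Γ, ∀ j ∈ jIdx ℓ j0,
      β r * χ (X F ℓ Γ j0 (β + s) j) + (j r : F) * χ (X F ℓ Γ j0 (β + s) (j - es r)) = 0) :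
    χ = 0 := by
  refine lin_ext ?_
  intro γ hγ
  have hβ : γ - s ∈ Γ := sub_mem hγ hs
  by_cases h0 : (γ - s) r = 0
  · intro j hj
    have := h (γ - s) hβ (j + es r) (jIdx_add ℓ hj (jIdx_es ℓ hr))
    rw [h0, sub_add_cancel, add_es_sub] at this
    have c := cast_ne (F := F) (j r)
    simpa [c] using this
  · suffices ∀ n, ∀ j ∈ jIdx ℓ j0, j r = n → χ (X F ℓ Γ j0 γ j) = 0 from
      fun j hj => this _ j hj rfl
    intro n
    induction n with
    | zero =>
      intro j hj hn
      have := h (γ - s) hβ j hj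
      rw [sub_add_cancel, hn] at this
      simp only [Nat.cast_zero, zero_mul, mul_zero, add_zero] at this
      exact (mul_eq_zero.1 this).resolve_left h0
    | succ n ih =>
      intro j hj hn
      have := h (γ - s) hβ j hj
      rw [sub_add_cancel, ih (j - es r) (jIdx_sub ℓ hj _) (by simp [hn])] at this
      simp only [Nat.cast_zero, zero_mul, mul_zero, add_zero] at this
      exact (mul_eq_zero.1 this).resolve_left h0

lemma bil_ext {ψ : CA F ℓ Γ j0 →ₗ[F] CA F ℓ Γ j0 →ₗ[F] F}
    (h : ∀ β ∈ Γ, ∀ j ∈ jIdx ℓ j0, ∀ β' ∈ Γ, ∀ j' ∈ jIdx ℓ j0,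
      ψ (X F ℓ Γ j0 β j) (X F ℓ Γ j0 β' j') = 0) : ψ = 0 :=
  lin_ext fun β hβ j hj => lin_ext fun β' hβ' j' hj' => h β hβ j hj β' hβ' j' hj'

lemma fin_lem {r r' : ℕ} (hrr : r ≠ r') (ε : F) (hr : allow ℓ j0 r)
    {ψ : CA F ℓ Γ j0 →ₗ[F] CA F ℓ Γ j0 →ₗ[F] F}
    (h : ∀ β ∈ Γ, ∀ j ∈ jIdx ℓ j0, ∀ β' ∈ Γ, ∀ j' ∈ jIdx ℓ j0,
      (β r + β' r - ε * (β r' + β' r')) * ψ (X F ℓ Γ j0 β j) (X F ℓ Γ j0 β' j')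
      + (j r : F) * ψ (X F ℓ Γ j0 β (j - es r)) (X F ℓ Γ j0 β' j')
      + (j' r : F) * ψ (X F ℓ Γ j0 β j) (X F ℓ Γ j0 β' (j' - es r))
      - ε * ((j r' : F) * ψ (X F ℓ Γ j0 β (j - es r')) (X F ℓ Γ j0 β' j'))
      - ε * ((j' r' : F) * ψ (X F ℓ Γ j0 β j) (X F ℓ Γ j0 β' (j' - es r'))) = 0) : ψ = 0 := by
  refine bil_ext fun β hβ => ?_
  suffices ∀ β' ∈ Γ, ∀ j ∈ jIdx ℓ j0, ∀ j' ∈ jIdx ℓ j0,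
      ψ (X F ℓ Γ j0 β j) (X F ℓ Γ j0 β' j') = 0 from
    fun j hj β' hβ' j' hj' => this β' hβ' j hj j' hj'
  intro β' hβ'
  by_cases hc : β r + β' r - ε * (β r' + β' r') = 0
  · suffices ∀ n, ∀ m, ∀ j ∈ jIdx ℓ j0, ∀ j' ∈ jIdx ℓ j0, j' r + j' r' = n → j r' = m →
        ψ (X F ℓ Γ j0 β j) (X F ℓ Γ j0 β' j') = 0 from
      fun j hj j' hj' => this _ _ j hj j' hj' rfl rfl
    intro n
    induction n using Nat.strong_induction_on with
    | _ n ihn =>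
    intro m
    induction m using Nat.strong_induction_on with
    | _ m ihm =>
    intro j hj j' hj' hn hm
    have hje := jIdx_add ℓ hj (jIdx_es ℓ hr)
    have key := h β hβ (j + es r) hje β' hβ' j' hj'
    rw [hc, add_es_sub] at key
    have e1 : (j' r : F) * ψ (X F ℓ Γ j0 β (j + es r)) (X F ℓ Γ j0 β' (j' - es r)) = 0 := by
      by_cases z : j' r = 0
      · simp [z]
      · rw [ihn (n - 1) (by omega) _ _ hje _ (jIdx_sub ℓ hj' _)
          (by simp [hrr.symm]; omega) rfl, mul_zero]
    have e2 : (j' r' : F) * ψ (X F ℓ Γ j0 β (j + es r)) (X F ℓ Γ j0 β' (j' - es r')) = 0 := by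
      by_cases z : j' r' = 0
      · simp [z]
      · rw [ihn (n - 1) (by omega) _ _ hje _ (jIdx_sub ℓ hj' _)
          (by simp [hrr]; omega) rfl, mul_zero]
    have e3 : (((j + es r) r' : ℕ) : F) *
        ψ (X F ℓ Γ j0 β (j + es r - es r')) (X F ℓ Γ j0 β' j') = 0 := by
      by_cases z : j r' = 0
      · simp [z, hrr.symm]
      · rw [ihm (m - 1) (by omega) _ (jIdx_sub ℓ hje _) _ hj' hn
          (by simp [hrr.symm]; omega), mul_zero]
    rw [e1, e2, e3] at key
    have c := cast_ne (F := F) (j r)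
    simpa [c] using key
  · suffices ∀ n, ∀ j ∈ jIdx ℓ j0, ∀ j' ∈ jIdx ℓ j0, j r + j r' + j' r + j' r' = n →
        ψ (X F ℓ Γ j0 β j) (X F ℓ Γ j0 β' j') = 0 from
      fun j hj j' hj' => this _ j hj j' hj' rfl
    intro n
    induction n using Nat.strong_induction_on with
    | _ n ihn =>
    intro j hj j' hj' hn
    have key := h β hβ j hj β' hβ' j' hj'
    have e1 : (j' r : F) * ψ (X F ℓ Γ j0 β j) (X F ℓ Γ j0 β' (j' - es r)) = 0 := by
      by_cases z : j' r = 0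
      · simp [z]
      · rw [ihn (n - 1) (by omega) _ hj _ (jIdx_sub ℓ hj' _)
          (by simp [hrr.symm]; omega), mul_zero]
    have e2 : (j' r' : F) * ψ (X F ℓ Γ j0 β j) (X F ℓ Γ j0 β' (j' - es r')) = 0 := by
      by_cases z : j' r' = 0
      · simp [z]
      · rw [ihn (n - 1) (by omega) _ hj _ (jIdx_sub ℓ hj' _)
          (by simp [hrr]; omega), mul_zero]
    have e3 : (j r : F) * ψ (X F ℓ Γ j0 β (j - es r)) (X F ℓ Γ j0 β' j') = 0 := by
      by_cases z : j r = 0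
      · simp [z]
      · rw [ihn (n - 1) (by omega) _ (jIdx_sub ℓ hj _) _ hj'
          (by simp [hrr.symm]; omega), mul_zero]
    have e4 : (j r' : F) * ψ (X F ℓ Γ j0 β (j - es r')) (X F ℓ Γ j0 β' j') = 0 := by
      by_cases z : j r' = 0
      · simp [z]
      · rw [ihn (n - 1) (by omega) _ (jIdx_sub ℓ hj _) _ hj'
          (by simp [hrr]; omega), mul_zero]
    rw [e1, e2, e3, e4] at key
    simpa [hc] using key

variable (Γ j0) in
/-- The element `z_r δ_r (x^{β,j})`. -/
def Er (ℓ : ℕ → ℕ) (r : ℕ) (β : ℕ → F) (j : ℕ → ℕ) : CA F ℓ Γ j0 :=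
  if r ∈ logS ℓ then β r • X F ℓ Γ j0 β j + (j r : F) • X F ℓ Γ j0 β (j - es r)
  else (j r : F) • X F ℓ Γ j0 β j

lemma ker_lem (φ : CA F ℓ Γ j0 →ₗ[F] F) (Pd : (ℕ → F) → (ℕ → ℕ) → Prop)
    (hP : ∀ β j r, Pd β j → Pd β (j - es r))
    (hd : ∀ β ∈ Γ, ∀ j ∈ jIdx ℓ j0, Pd β j → (4 - deg ℓ β j) * φ (X F ℓ Γ j0 β j) = 0)
    (nr : ℕ → ℕ)
    (hE : ∀ r, r ∈ logS ℓ ∨ r ∈ polS ℓ → ∀ β ∈ Γ, ∀ j ∈ jIdx ℓ j0, Pd β j →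
      φ (Er Γ j0 ℓ r β j) + (nr r : F) * φ (X F ℓ Γ j0 β j) = 0) :
    ∀ β ∈ Γ, ∀ j ∈ jIdx ℓ j0, Pd β j → φ (X F ℓ Γ j0 β j) = 0 := by
  intro β hβ
  suffices ∀ n, ∀ j ∈ jIdx ℓ j0, ∑ r ∈ logS ℓ, j r = n → Pd β j → φ (X F ℓ Γ j0 β j) = 0 from
    fun j hj => this _ j hj rfl
  intro n
  induction n using Nat.strong_induction_on with
  | _ n ih =>
  intro j hj hn hp
  by_contra hne
  have hlog : ∀ r ∈ logS ℓ, β r = -(nr r : F) := by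
    intro r hr
    have key := hE r (Or.inl hr) β hβ j hj hp
    rw [Er, if_pos hr, map_add, map_smul, map_smul, smul_eq_mul, smul_eq_mul] at key
    have e : (j r : F) * φ (X F ℓ Γ j0 β (j - es r)) = 0 := by
      by_cases z : j r = 0
      · simp [z]
      · rw [ih (∑ r' ∈ logS ℓ, (j - es r) r') ?_ _ (jIdx_sub ℓ hj _) rfl (hP _ _ _ hp), mul_zero]
        rw [← hn]
        refine Finset.sum_lt_sum (fun i _ => by simp) ⟨r, hr, ?_⟩
        simp; omega
    rw [e, add_zero, ← add_mul] at key
    rcases mul_eq_zero.1 key with k | k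
    · linear_combination k
    · exact absurd k hne
  have hpol : ∀ r ∈ polS ℓ, (j r : F) = -(nr r : F) := by
    intro r hr
    have key := hE r (Or.inr hr) β hβ j hj hp
    rw [Er, if_neg (pol_not_log hr), map_smul, smul_eq_mul, ← add_mul] at key
    rcases mul_eq_zero.1 key with k | k
    · linear_combination k
    · exact absurd k hne
  have hdeg : deg ℓ β j = -((∑ r ∈ logS ℓ, nr r + ∑ r ∈ polS ℓ, nr r : ℕ) : F) := by
    rw [deg, Finset.sum_congr rfl hlog, Finset.sum_congr rfl hpol]
    push_cast
    rw [Finset.sum_neg_distrib, Finset.sum_neg_distrib]; ring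
  have := hd β hβ j hj hp
  rcases mul_eq_zero.1 this with k | k
  · rw [hdeg, sub_neg_eq_add] at k
    have : ((4 + (∑ r ∈ logS ℓ, nr r + ∑ r ∈ polS ℓ, nr r) : ℕ) : F) = 0 := by
      rw [← k]; push_cast; ring
    rw [Nat.cast_eq_zero] at this
    omega
  · exact hne k

end Gen
end KH2
end

noncomputable section
namespace KH2
set_option linter.unusedSectionVars false
set_option linter.unusedSimpArgs false

section Br
variable {F : Type*} [Field F] [CharZero F] {ℓ : ℕ → ℕ} {Γ : AddSubgroup (ℕ → F)} {j0 : Bool}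

lemma brB_free {u : BB F} (h : ∀ r, 1 ≤ r → dl F ℓ r u = 0) (v : BB F) :
    brB F ℓ u v = (2 * u - EE F ℓ u) * d00 F v - d00 F u * (2 * v - EE F ℓ v) := by
  have : pb (iSet ℓ 1 6) (fun q => dl F ℓ q) (fun q => dl F ℓ (q + iot ℓ 6)) u v = 0 := by
    refine Finset.sum_eq_zero fun q hq => ?_
    have := one_le_of_iSet hq
    rw [h q this.1, h (q + iot ℓ 6) (by omega)]; simp
  rw [brB, cb, this, zero_add]

lemma brB_one {u : BB F} {p : ℕ} (hp1 : 1 ≤ p) (hp2 : p ≤ iot ℓ 6) (h0 : d00 F u = 0)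
    (h : ∀ r, 1 ≤ r → r ≠ p → r ≠ p + iot ℓ 6 → dl F ℓ r u = 0) (v : BB F) :
    brB F ℓ u v = dl F ℓ p u * dl F ℓ (p + iot ℓ 6) v - dl F ℓ (p + iot ℓ 6) u * dl F ℓ p v
      + (2 * u - EE F ℓ u) * d00 F v := by
  have : pb (iSet ℓ 1 6) (fun q => dl F ℓ q) (fun q => dl F ℓ (q + iot ℓ 6)) u v =
      dl F ℓ p u * dl F ℓ (p + iot ℓ 6) v - dl F ℓ (p + iot ℓ 6) u * dl F ℓ p v := by
    refine Finset.sum_eq_single_of_mem p ?_ fun q hq hqp => ?_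
    · rw [mem_iSet]; simp [iot_zero]; omega
    · have := one_le_of_iSet hq
      rw [h q this.1 hqp (by omega), h (q + iot ℓ 6) (by omega) (by omega) (by omega)]; simp
  rw [brB, cb, this, h0, zero_mul, sub_zero]

/-- the variable `z_r` -/
def za (F : Type*) [Field F] (ℓ : ℕ → ℕ) (r : ℕ) : ℕ → F := if r ∈ logS ℓ then Pi.single r 1 else 0
def zi (ℓ : ℕ → ℕ) (r : ℕ) : ℕ → ℕ := if r ∈ logS ℓ then 0 else es r

lemma za_mem (H : Hyp ℓ Γ j0) (r : ℕ) : za F ℓ r ∈ Γ := by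
  rw [za]; split_ifs with h
  · exact H.h1 r h
  · exact zero_mem _

lemma zi_mem {r : ℕ} (h : r ∈ logS ℓ ∨ r ∈ polS ℓ) : zi ℓ r ∈ jIdx ℓ j0 := by
  rw [zi]; split_ifs with h'
  · exact jIdx_zero _ _
  · exact jIdx_es _ (pol_allow (by tauto))

lemma za_ne {r s : ℕ} (h : s ≠ r) : za F ℓ r s = 0 := by
  rw [za]; split_ifs <;> simp [h]

lemma zi_ne {r s : ℕ} (h : s ≠ r) : zi ℓ r s = 0 := by
  rw [zi]; split_ifs <;> simp [h]

lemma dl_z_self (r : ℕ) : dl F ℓ r (mon (za F ℓ r) (zi ℓ r)) = 1 := by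
  by_cases h : r ∈ logS ℓ
  · rw [dl_log_mon h, za, zi, if_pos h, if_pos h, sub_self, mon_zero]; simp
  · rw [dl_nlog h, dT_mon, za, zi, if_neg h, if_neg h, tsub_self, mon_zero]; simp

lemma deg_z {r : ℕ} (h : r ∈ logS ℓ ∨ r ∈ polS ℓ) : deg ℓ (za F ℓ r) (zi ℓ r) = 1 := by
  rw [deg, za, zi]
  by_cases h' : r ∈ logS ℓ
  · rw [if_pos h', if_pos h', Finset.sum_pi_single', if_pos h']; simp
  · rw [if_neg h', if_neg h', Finset.sum_eq_single_of_mem (s := polS ℓ) r (by tauto)]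
    · simp
    · intro b _ hb; simp [hb]

lemma z_dl (r : ℕ) (β : ℕ → F) (j : ℕ → ℕ) :
    mon (za F ℓ r) (zi ℓ r) * dl F ℓ r (mon β j) =
      if r ∈ logS ℓ then β r • mon β j + (j r : F) • mon β (j - es r)
      else (j r : F) • mon β j := by
  by_cases h : r ∈ logS ℓ
  · rw [dl_log_mon h, za, zi, if_pos h, if_pos h, if_pos h, mul_add, mul_smul_comm, mul_smul_comm,
      mon_mul, mon_mul, zero_add, zero_add, add_sub_cancel]
  · rw [dl_nlog h, za, zi, if_neg h, if_neg h, if_neg h, t_dT]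

lemma Phi_Er (r : ℕ) {β : ℕ → F} {j : ℕ → ℕ} (hβ : β ∈ Γ) (hj : j ∈ jIdx ℓ j0) :
    Phi F ℓ Γ j0 (Er Γ j0 ℓ r β j) = mon (za F ℓ r) (zi ℓ r) * dl F ℓ r (mon β j) := by
  rw [z_dl, Er]
  split_ifs
  · rw [map_add, map_smul, map_smul, Phi_X hβ hj, Phi_X hβ (jIdx_sub ℓ hj _)]
  · rw [map_smul, Phi_X hβ hj]

lemma d00_mon_zero {β : ℕ → F} {j : ℕ → ℕ} (h1 : β 0 = 0) (h2 : j 0 = 0) :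
    d00 F (mon β j) = 0 := by
  rw [d00_mon, h1, h2]; simp

/-- the variable `z_r` in the algebra -/
abbrev ZZ (F : Type*) [Field F] (ℓ : ℕ → ℕ) (Γ : AddSubgroup (ℕ → F)) (j0 : Bool) (r : ℕ) :
    CA F ℓ Γ j0 := X F ℓ Γ j0 (za F ℓ r) (zi ℓ r)

lemma dl_zv (r : ℕ) (β : ℕ → F) (j : ℕ → ℕ) :
    dl F ℓ r (mon (za F ℓ r + β) (zi ℓ r + j)) =
      mon β j + mon (za F ℓ r) (zi ℓ r) * dl F ℓ r (mon β j) := by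
  rw [← mon_mul, Derivation.leibniz, dl_z_self, smul_eq_mul, smul_eq_mul, mul_one, add_comm]

lemma z_zero {r : ℕ} (h : r ∈ logS ℓ ∨ r ∈ polS ℓ) : za F ℓ r 0 = 0 ∧ zi ℓ r 0 = 0 := by
  have : (0 : ℕ) ≠ r := by
    rintro rfl; have := zero_not_mem (ℓ := ℓ); tauto
  exact ⟨za_ne this, zi_ne this⟩

/-- `[z_q, z_{q̄} v] = v + E_{q̄} v`. -/
lemma br_z1 (H : Hyp ℓ Γ j0) {q : ℕ} (hq1 : 1 ≤ q) (hq2 : q ≤ iot ℓ 6) {β : ℕ → F} {j : ℕ → ℕ}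
    (hβ : β ∈ Γ) (hj : j ∈ jIdx ℓ j0) (h0 : β 0 = 0) (h0' : j 0 = 0) :
    brk F ℓ Γ j0 (ZZ F ℓ Γ j0 q)
      (X F ℓ Γ j0 (za F ℓ (q + iot ℓ 6) + β) (zi ℓ (q + iot ℓ 6) + j)) =
      X F ℓ Γ j0 β j + Er Γ j0 ℓ (q + iot ℓ 6) β j := by
  have lq : q ∈ logS ℓ ∨ q ∈ polS ℓ := log_or_pol (by omega) (by omega)
  have lq' : (q + iot ℓ 6) ∈ logS ℓ ∨ (q + iot ℓ 6) ∈ polS ℓ := log_or_pol (by omega) (by omega)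
  apply Phi_inj
  rw [Phi_brk H, Phi_X (za_mem H _) (zi_mem lq),
    Phi_X (add_mem (za_mem H _) hβ) (jIdx_add ℓ (zi_mem lq') hj), map_add, Phi_X hβ hj,
    Phi_Er _ hβ hj]
  have n : q + iot ℓ 6 ≠ q := by have := H.hn; omega
  rw [brB_one hq1 hq2 (d00_mon_zero (z_zero lq).1 (z_zero (F := F) lq).2)
    (fun r _ h1 _ => dl_mon_zero (za_ne h1) (zi_ne h1)),
    dl_z_self, dl_mon_zero (za_ne n) (zi_ne n), dl_zv,
    d00_mon_zero (β := _ + β) (by simp [h0, (z_zero lq').1]) (by simp [h0', (z_zero (F := F) lq').2])]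
  ring

/-- `[z_{q̄}, z_q v] = -(v + E_q v)`. -/
lemma br_z2 (H : Hyp ℓ Γ j0) {q : ℕ} (hq1 : 1 ≤ q) (hq2 : q ≤ iot ℓ 6) {β : ℕ → F} {j : ℕ → ℕ}
    (hβ : β ∈ Γ) (hj : j ∈ jIdx ℓ j0) (h0 : β 0 = 0) (h0' : j 0 = 0) :
    brk F ℓ Γ j0 (ZZ F ℓ Γ j0 (q + iot ℓ 6))
      (X F ℓ Γ j0 (za F ℓ q + β) (zi ℓ q + j)) =
      -(X F ℓ Γ j0 β j + Er Γ j0 ℓ q β j) := by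
  have lq : q ∈ logS ℓ ∨ q ∈ polS ℓ := log_or_pol (by omega) (by omega)
  have lq' : (q + iot ℓ 6) ∈ logS ℓ ∨ (q + iot ℓ 6) ∈ polS ℓ := log_or_pol (by omega) (by omega)
  apply Phi_inj
  rw [Phi_brk H, Phi_X (za_mem H _) (zi_mem lq'),
    Phi_X (add_mem (za_mem H _) hβ) (jIdx_add ℓ (zi_mem lq) hj), map_neg, map_add, Phi_X hβ hj,
    Phi_Er _ hβ hj]
  have n : q ≠ q + iot ℓ 6 := by have := H.hn; omega
  rw [brB_one hq1 hq2 (d00_mon_zero (z_zero lq').1 (z_zero (F := F) lq').2)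
    (fun r _ _ h1 => dl_mon_zero (za_ne h1) (zi_ne h1)),
    dl_z_self, dl_mon_zero (za_ne n) (zi_ne n), dl_zv,
    d00_mon_zero (β := _ + β) (by simp [h0, (z_zero lq).1]) (by simp [h0', (z_zero (F := F) lq).2])]
  ring

/-- `[1, v] = 2 ∂₀ v`. -/
lemma br_one (H : Hyp ℓ Γ j0) {β : ℕ → F} {j : ℕ → ℕ} (hβ : β ∈ Γ) (hj : j ∈ jIdx ℓ j0) :
    brk F ℓ Γ j0 (X F ℓ Γ j0 0 0) (X F ℓ Γ j0 β j) =
      (2 : F) • (β 0 • X F ℓ Γ j0 β j + (j 0 : F) • X F ℓ Γ j0 β (j - es 0)) := by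
  apply Phi_inj
  rw [Phi_brk H, Phi_X (zero_mem _) (jIdx_zero ℓ j0), Phi_X hβ hj, map_smul, map_add, map_smul,
    map_smul, Phi_X hβ hj, Phi_X hβ (jIdx_sub ℓ hj _), ← d00_mon, mon_zero,
    brB_free (fun r _ => by simp)]
  simp [two_smul, two_mul]

lemma br_t0 (H : Hyp ℓ Γ j0) (hz : j0 = true) {β : ℕ → F} {j : ℕ → ℕ} (hβ : β ∈ Γ)
    (hj : j ∈ jIdx ℓ j0) (h0 : β 0 = 0) (h0' : j 0 = 0) :
    brk F ℓ Γ j0 (X F ℓ Γ j0 0 (es 0)) (X F ℓ Γ j0 β j) =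
      (deg ℓ β j - 2) • X F ℓ Γ j0 β j := by
  have hz0 : ∀ r, 1 ≤ r → dl F ℓ r (mon 0 (es 0)) = 0 := fun r hr =>
    dl_mon_zero rfl (Pi.single_eq_of_ne (by omega) _)
  apply Phi_inj
  rw [Phi_brk H, Phi_X (zero_mem _) (jIdx_es ℓ (Or.inl ⟨rfl, hz⟩)), Phi_X hβ hj, map_smul,
    Phi_X hβ hj,
    brB_free hz0, d00_mon_zero h0 h0',
    d00_mon, EE_mon]
  simp [mon_zero, sub_smul, two_smul, two_mul, EE_mon]

lemma br_x0 (H : Hyp ℓ Γ j0) (hz : j0 = false) {β : ℕ → F} {j : ℕ → ℕ} (hβ : β ∈ Γ)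
    (hj : j ∈ jIdx ℓ j0) (h0 : β 0 = 0) (h0' : j 0 = 0) :
    brk F ℓ Γ j0 (X F ℓ Γ j0 (-Pi.single 0 1) 0) (X F ℓ Γ j0 (β + Pi.single 0 1) j) =
      (4 - deg ℓ β j) • X F ℓ Γ j0 β j := by
  apply Phi_inj
  have hd : deg ℓ (-Pi.single 0 (1 : F)) 0 = 0 := by
    rw [deg, Finset.sum_eq_zero, Finset.sum_eq_zero, add_zero]
    · intro x hx; simp
    · intro x hx
      have : x ≠ 0 := by rintro rfl; exact zero_not_mem.1 hx
      simp [this]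
  have hd' : deg ℓ (β + Pi.single 0 (1 : F)) j = deg ℓ β j := by
    rw [deg, deg]; congr 1
    refine Finset.sum_congr rfl fun x hx => ?_
    have : x ≠ 0 := by rintro rfl; exact zero_not_mem.1 hx
    simp [this]
  have hz0 : ∀ r, 1 ≤ r → dl F ℓ r (mon (-Pi.single 0 (1 : F)) 0) = 0 := fun r hr =>
    dl_mon_zero (by simp [show r ≠ 0 by omega]) rfl
  rw [Phi_brk H, Phi_X (neg_mem (H.hz hz)) (jIdx_zero _ _), Phi_X (add_mem hβ (H.hz hz)) hj,
    map_smul, Phi_X hβ hj,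
    brB_free hz0, d00_mon, d00_mon, EE_mon,
    EE_mon, hd, hd', h0', Pi.add_apply, h0]
  have e : mon (-Pi.single 0 (1 : F)) 0 * mon (β + Pi.single 0 1) j = mon β j := by
    rw [mon_mul, zero_add, neg_add_eq_sub, add_sub_cancel_right]
  simp only [Pi.single_eq_same, Pi.neg_apply, zero_add, Nat.cast_zero, zero_smul, add_zero,
    Pi.zero_apply, sub_zero, one_smul, neg_smul, neg_mul, two_mul, mul_add, add_mul, mul_sub, e,
    mul_smul_comm, sub_smul]
  module

end Br
end KH2
end

noncomputable section
namespace KH2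
set_option linter.unusedSectionVars false
set_option linter.unusedSimpArgs false

section CaseA
variable {F : Type*} [Field F] [CharZero F] {ℓ : ℕ → ℕ} {Γ : AddSubgroup (ℕ → F)} {j0 : Bool}

lemma range_of {r : ℕ} (h : r ∈ logS ℓ ∨ r ∈ polS ℓ) : 1 ≤ r ∧ r ≤ 2 * iot ℓ 6 := by
  have := iot_mono ℓ
  rw [mem_logS, mem_polS] at h; omega

lemma bar_range {r : ℕ} (h : 1 ≤ r ∧ r ≤ 2 * iot ℓ 6) :
    1 ≤ bar ℓ r ∧ bar ℓ r ≤ 2 * iot ℓ 6 := by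
  rw [bar]; split_ifs <;> omega

lemma hE_of (H : Hyp ℓ Γ j0) (φ : CA F ℓ Γ j0 →ₗ[F] F) {r : ℕ} (hr : r ∈ logS ℓ ∨ r ∈ polS ℓ)
    {β : ℕ → F} {j : ℕ → ℕ} (hβ : β ∈ Γ) (hj : j ∈ jIdx ℓ j0) (h0 : β 0 = 0) (h0' : j 0 = 0)
    (h : φ (brk F ℓ Γ j0 (ZZ F ℓ Γ j0 (bar ℓ r)) (X F ℓ Γ j0 (za F ℓ r + β) (zi ℓ r + j))) = 0) :
    φ (Er Γ j0 ℓ r β j) + ((1 : ℕ) : F) * φ (X F ℓ Γ j0 β j) = 0 := by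
  have hr' := range_of hr
  by_cases hn : r ≤ iot ℓ 6
  · rw [bar, if_pos hn, br_z2 H hr'.1 hn hβ hj h0 h0', map_neg, map_add] at h
    push_cast; linear_combination -h
  · obtain ⟨q, rfl⟩ : ∃ q, r = (q + 1) + iot ℓ 6 := ⟨r - iot ℓ 6 - 1, by omega⟩
    rw [bar, if_neg hn, Nat.add_sub_cancel, br_z1 H (by omega) (by omega) hβ hj h0 h0',
      map_add] at h
    push_cast; linear_combination h

lemma br_one_zero (H : Hyp ℓ Γ j0) {β : ℕ → F} {j : ℕ → ℕ} (hβ : β ∈ Γ) (hj : j ∈ jIdx ℓ j0)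
    (h0 : β 0 = 0) (h0' : j 0 = 0) :
    brk F ℓ Γ j0 (X F ℓ Γ j0 0 0) (X F ℓ Γ j0 β j) = 0 := by
  rw [br_one H hβ hj, h0, h0']; simp

lemma caseA (H : Hyp ℓ Γ j0) (hz : j0 = true)
    {ψ : CA F ℓ Γ j0 →ₗ[F] CA F ℓ Γ j0 →ₗ[F] F} (C : Coc ψ) :
    ∃ f : CA F ℓ Γ j0 →ₗ[F] F, ∀ u v : CA F ℓ Γ j0, ψ u v = f (brk F ℓ Γ j0 u v) := by
  have a0 : allow ℓ j0 0 := Or.inl ⟨rfl, hz⟩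
  have hker := ker_lem (ψ (X F ℓ Γ j0 0 0)) (fun β j => β 0 = 0 ∧ j 0 = 0)
    (fun β j r h => ⟨h.1, by simp [h.2]⟩)
    (fun β hβ j hj h => by
      have k := C.inv H (X F ℓ Γ j0 0 0) (X F ℓ Γ j0 0 (es 0)) (X F ℓ Γ j0 β j)
      rw [br_t0 H hz hβ hj h.1 h.2, br_one_zero H hβ hj h.1 h.2,
        br_one H (zero_mem _) (jIdx_es ℓ a0)] at k
      simp at k
      rcases k with k | k
      · rw [show (4 : F) - deg ℓ β j = 0 by linear_combination -k, zero_mul]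
      · rw [k, mul_zero])
    (fun _ => 1)
    (fun r hr β hβ j hj h => by
      refine hE_of H _ hr hβ hj h.1 h.2 ?_
      have hb := bar_range (range_of hr)
      have hb' := log_or_pol hb.1 hb.2
      rw [C.inv H, br_one_zero H (za_mem H _) (zi_mem hb') (z_zero hb').1 (z_zero (F := F) hb').2,
        br_one_zero H (add_mem (za_mem H _) hβ) (jIdx_add ℓ (zi_mem hr) hj)
          (by simp [h.1, (z_zero (F := F) hr).1]) (by simp [h.2, (z_zero (F := F) hr).2])]
      simp)
  obtain ⟨f, hf⟩ := solve (r := 0) (s := 0) (zero_mem Γ) ((2 : F)⁻¹ • ψ (X F ℓ Γ j0 0 0))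
    (fun β hβ j hj h h' => by simp [hker β hβ j hj ⟨h, h'⟩])
  refine exists_of_sub H f ?_
  have C' := C.sub H f
  set ψ' := ψ - (brL H).compr₂ f with hψ'
  have h1 : ψ' (X F ℓ Γ j0 0 0) = 0 := by
    refine lin_ext fun β hβ j hj => ?_
    have k := hf β hβ j hj
    rw [hψ']
    simp only [LinearMap.sub_apply, LinearMap.compr₂_apply, brL_apply]
    rw [br_one H hβ hj]
    simp only [map_smul, map_add, smul_eq_mul, LinearMap.smul_apply, add_zero] at k ⊢
    rw [k]; ring
  refine fin_lem (r := 0) (r' := 1) (by simp) 0 a0 fun β hβ j hj β' hβ' j' hj' => ?_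
  have k := C'.inv H (X F ℓ Γ j0 0 0) (X F ℓ Γ j0 β j) (X F ℓ Γ j0 β' j')
  rw [h1, br_one H hβ hj, br_one H hβ' hj'] at k
  simp only [map_smul, map_add, smul_eq_mul, LinearMap.smul_apply, LinearMap.add_apply,
    LinearMap.zero_apply] at k
  have h2 : (2 : F) ≠ 0 := two_ne_zero
  apply mul_left_cancel₀ h2
  linear_combination -k

end CaseA
end KH2
end

noncomputable section
namespace KH2
set_option linter.unusedSectionVars false
set_option linter.unusedSimpArgs false

section CaseB
variable {F : Type*} [Field F] [CharZero F] {ℓ : ℕ → ℕ} {Γ : AddSubgroup (ℕ → F)} {j0 : Bool}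

lemma deg_add (β β' : ℕ → F) (j j' : ℕ → ℕ) :
    deg ℓ (β + β') (j + j') = deg ℓ β j + deg ℓ β' j' := by
  simp only [deg, Pi.add_apply, Nat.cast_add, Finset.sum_add_distrib]; ring

/-- The monomial `z_p z_{p̄}`. -/
abbrev WW (F : Type*) [Field F] (ℓ : ℕ → ℕ) (Γ : AddSubgroup (ℕ → F)) (j0 : Bool) (p : ℕ) :
    CA F ℓ Γ j0 :=
  X F ℓ Γ j0 (za F ℓ p + za F ℓ (p + iot ℓ 6)) (zi ℓ p + zi ℓ (p + iot ℓ 6))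

lemma br_w (H : Hyp ℓ Γ j0) {p : ℕ} (hp1 : 1 ≤ p) (hp2 : p ≤ iot ℓ 6) {β : ℕ → F} {j : ℕ → ℕ}
    (hβ : β ∈ Γ) (hj : j ∈ jIdx ℓ j0) :
    brk F ℓ Γ j0 (WW F ℓ Γ j0 p) (X F ℓ Γ j0 β j) =
      Er Γ j0 ℓ (p + iot ℓ 6) β j - Er Γ j0 ℓ p β j := by
  have lq : p ∈ logS ℓ ∨ p ∈ polS ℓ := log_or_pol (by omega) (by omega)
  have lq' : (p + iot ℓ 6) ∈ logS ℓ ∨ (p + iot ℓ 6) ∈ polS ℓ := log_or_pol (by omega) (by omega)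
  have n : p ≠ p + iot ℓ 6 := by have := H.hn; omega
  apply Phi_inj
  rw [Phi_brk H, Phi_X (add_mem (za_mem H _) (za_mem H _)) (jIdx_add ℓ (zi_mem lq) (zi_mem lq')),
    Phi_X hβ hj, map_sub, Phi_Er _ hβ hj, Phi_Er _ hβ hj]
  rw [brB_one hp1 hp2 (d00_mon_zero (by simp [(z_zero (F := F) lq).1, (z_zero (F := F) lq').1])
      (by simp [(z_zero (F := F) lq).2, (z_zero (F := F) lq').2]))
    (fun r _ h1 h2 => dl_mon_zero (by simp [za_ne h1, za_ne h2]) (by simp [zi_ne h1, zi_ne h2])),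
    EE_mon, deg_add, deg_z lq, deg_z lq', ← mon_mul, Derivation.leibniz, Derivation.leibniz,
    dl_z_self, dl_z_self, dl_mon_zero (za_ne n) (zi_ne n), dl_mon_zero (za_ne n.symm) (zi_ne n.symm)]
  simp only [smul_eq_mul, mul_one, mul_zero, zero_add, add_zero, add_smul, one_smul, two_mul,
    sub_self, zero_mul]

/-- The monomial `z_p^2`. -/
abbrev GG (F : Type*) [Field F] (ℓ : ℕ → ℕ) (Γ : AddSubgroup (ℕ → F)) (j0 : Bool) (p : ℕ) :
    CA F ℓ Γ j0 := X F ℓ Γ j0 (Pi.single p 1 + Pi.single p 1) 0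

/-- shift vector -/
abbrev sv (F : Type*) [Field F] (ℓ : ℕ → ℕ) (p : ℕ) : ℕ → F :=
  Pi.single p 1 + ax F ℓ (p + iot ℓ 6)

lemma br_g (H : Hyp ℓ Γ j0) {p : ℕ} (hp1 : 1 ≤ p) (hp2 : p ≤ iot ℓ 6) (hl : p ∈ logS ℓ)
    {β : ℕ → F} {j : ℕ → ℕ} (hβ : β ∈ Γ) (hj : j ∈ jIdx ℓ j0) :
    brk F ℓ Γ j0 (GG F ℓ Γ j0 p) (X F ℓ Γ j0 β j) =
      (2 : F) • (β (p + iot ℓ 6) • X F ℓ Γ j0 (β + sv F ℓ p) j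
        + (j (p + iot ℓ 6) : F) • X F ℓ Γ j0 (β + sv F ℓ p) (j - es (p + iot ℓ 6))) := by
  have lq' : (p + iot ℓ 6) ∈ logS ℓ ∨ (p + iot ℓ 6) ∈ polS ℓ := log_or_pol (by omega) (by omega)
  have n : p ≠ p + iot ℓ 6 := by have := H.hn; omega
  have hm := H.h1 p hl
  have s1 : (Pi.single p (1 : F) : ℕ → F) (p + iot ℓ 6) = 0 := Pi.single_eq_of_ne n.symm _
  have hs : β + sv F ℓ p ∈ Γ := add_mem hβ (add_mem hm (ax_mem H _))
  have hdd : deg ℓ (Pi.single p (1 : F) + Pi.single p (1 : F) : ℕ → F) 0 = 1 + 1 := by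
    have e : deg ℓ (Pi.single p (1 : F)) 0 = 1 := by
      have := deg_z (F := F) (Or.inl hl); rwa [za, zi, if_pos hl, if_pos hl] at this
    have := deg_add (ℓ := ℓ) (Pi.single p (1 : F)) (Pi.single p (1 : F)) 0 0
    rwa [e, add_zero] at this
  apply Phi_inj
  rw [Phi_brk H, Phi_X (add_mem hm hm) (jIdx_zero _ _),
    Phi_X hβ hj, map_smul, map_add, map_smul, map_smul, Phi_X hs hj, Phi_X hs (jIdx_sub ℓ hj _)]
  have hu0 : d00 F (mon (Pi.single p (1 : F) + Pi.single p (1 : F) : ℕ → F) 0) = 0 :=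
    d00_mon_zero (by simp [show (0 : ℕ) ≠ p by omega]) rfl
  have hu : ∀ r, r ≠ p →
      dl F ℓ r (mon (Pi.single p (1 : F) + Pi.single p (1 : F) : ℕ → F) 0) = 0 :=
    fun r h1 => dl_mon_zero (by simp [h1]) rfl
  rw [brB_one hp1 hp2 hu0 (fun r _ h1 _ => hu r h1),
    EE_mon, hdd, hu _ n.symm, dl_log_mon hl]
  have key : mon (Pi.single p (1 : F)) 0 * dl F ℓ (p + iot ℓ 6) (mon β j) =
      β (p + iot ℓ 6) • mon (β + sv F ℓ p) j
        + (j (p + iot ℓ 6) : F) • mon (β + sv F ℓ p) (j - es (p + iot ℓ 6)) := by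
    by_cases h : (p + iot ℓ 6) ∈ logS ℓ
    · rw [dl_log_mon h, mul_add, mul_smul_comm, mul_smul_comm, mon_mul, mon_mul, zero_add,
        zero_add, sv, ax, if_pos h]
      have e : (Pi.single p (1 : F) + (β - Pi.single (p + iot ℓ 6) 1) : ℕ → F) =
        β + (Pi.single p 1 + -Pi.single (p + iot ℓ 6) 1) := by abel
      rw [e]
    · rw [dl_nlog h, dT_mon, H.h2 β hβ _ (by tauto), zero_smul, zero_add, mul_smul_comm, mon_mul,
        sv, ax, if_neg h, add_zero, zero_add, add_comm β]
  rw [← key]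
  simp only [Pi.add_apply, Pi.single_eq_same, Pi.zero_apply, Nat.cast_zero, zero_smul, add_zero,
    add_sub_cancel_right, zero_mul, sub_zero, add_smul, one_smul, two_mul, sub_self, two_smul,
    add_mul]

lemma caseB (H : Hyp ℓ Γ j0) (hz : j0 = false) {p : ℕ} (hp1 : iot ℓ 1 + 1 ≤ p) (hp5 : p ≤ iot ℓ 5)
    {ψ : CA F ℓ Γ j0 →ₗ[F] CA F ℓ Γ j0 →ₗ[F] F} (C : Coc ψ) :
    ∃ f : CA F ℓ Γ j0 →ₗ[F] F, ∀ u v : CA F ℓ Γ j0, ψ u v = f (brk F ℓ Γ j0 u v) := by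
  have hi := iot_mono ℓ
  have hp6 : p ≤ iot ℓ 6 := by omega
  have hp0 : 1 ≤ p := by omega
  have hl : p ∈ logS ℓ := by rw [mem_logS]; omega
  have lq : p ∈ logS ℓ ∨ p ∈ polS ℓ := Or.inl hl
  have lq' : (p + iot ℓ 6) ∈ logS ℓ ∨ (p + iot ℓ 6) ∈ polS ℓ := log_or_pol (by omega) (by omega)
  have n : p ≠ p + iot ℓ 6 := by have := H.hn; omega
  have n0 : p + iot ℓ 6 ≠ 0 := by omega
  have s0 : (Pi.single 0 (1 : F) : ℕ → F) (p + iot ℓ 6) = 0 := Pi.single_eq_of_ne n0 _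
  have al : allow ℓ j0 (p + iot ℓ 6) := by rw [allow]; omega
  have hm := H.h1 p hl
  have s1 : (Pi.single p (1 : F) : ℕ → F) (p + iot ℓ 6) = 0 := Pi.single_eq_of_ne n.symm _
  have hs : sv F ℓ p ∈ Γ := add_mem hm (ax_mem H _)
  have hj00 : ∀ j ∈ jIdx ℓ j0, j 0 = 0 := by
    intro j hj
    rw [mem_jIdx] at hj
    apply hj; simp [allow, hz]
  have br0 : ∀ β ∈ Γ, ∀ j ∈ jIdx ℓ j0, β (p + iot ℓ 6) = 0 → j (p + iot ℓ 6) = 0 →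
      brk F ℓ Γ j0 (GG F ℓ Γ j0 p) (X F ℓ Γ j0 β j) = 0 := by
    intro β hβ j hj h h'
    rw [br_g H hp0 hp6 hl hβ hj, h, h']; simp
  have brgw : brk F ℓ Γ j0 (GG F ℓ Γ j0 p) (WW F ℓ Γ j0 p) = (2 : F) • GG F ℓ Γ j0 p := by
    rw [brk_skew H, br_w H hp0 hp6 (add_mem hm hm) (jIdx_zero _ _)]
    have e1 : Er Γ j0 ℓ (p + iot ℓ 6) (Pi.single p (1 : F) + Pi.single p 1) 0 = 0 := by
      rw [Er]; simp [s1]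
    have e2 : Er Γ j0 ℓ p (Pi.single p (1 : F) + Pi.single p 1) 0 = (2 : F) • GG F ℓ Γ j0 p := by
      rw [Er, if_pos hl]; simp [one_add_one_eq_two]
    rw [e1, e2]; simp
  have hker0 := ker_lem (ψ (GG F ℓ Γ j0 p))
    (fun β j => β 0 = 0 ∧ β (p + iot ℓ 6) = 0 ∧ j (p + iot ℓ 6) = 0)
    (fun β j r h => ⟨h.1, h.2.1, by simp [h.2.2]⟩)
    (fun β hβ j hj h => by
      have k := C.inv H (GG F ℓ Γ j0 p) (X F ℓ Γ j0 (-Pi.single 0 1) 0)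
        (X F ℓ Γ j0 (β + Pi.single 0 1) j)
      rw [br_x0 H hz hβ hj h.1 (hj00 j hj),
        br0 _ (neg_mem (H.hz hz)) _ (jIdx_zero _ _) (by simp [s0]) rfl,
        br0 _ (add_mem hβ (H.hz hz)) _ hj (by simp [s0, h.2.1]) h.2.2] at k
      simpa using k)
    (fun r => if r = p then 2 else if r = p + iot ℓ 6 then 0 else 1)
    (fun r hr β hβ j hj h => by
      have e1 : Er Γ j0 ℓ (p + iot ℓ 6) β j = 0 := by rw [Er, h.2.1, h.2.2]; simp
      by_cases hrp : r = p
      · subst hrp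
        have k := C.inv H (GG F ℓ Γ j0 r) (WW F ℓ Γ j0 r) (X F ℓ Γ j0 β j)
        rw [br_w H hp0 hp6 hβ hj, e1, brgw, br0 β hβ j hj h.2.1 h.2.2] at k
        simp only [zero_sub, map_neg, map_smul, LinearMap.smul_apply, smul_eq_mul, map_zero,
          add_zero] at k
        rw [if_pos rfl]; push_cast; linear_combination -k
      by_cases hrp' : r = p + iot ℓ 6
      · subst hrp'
        rw [if_neg n.symm, if_pos rfl, e1]; simp
      · rw [if_neg hrp, if_neg hrp']
        refine hE_of H _ hr hβ hj h.1 (hj00 j hj) ?_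
        have hb := bar_range (range_of hr)
        have hb' := log_or_pol hb.1 hb.2
        have nb : p + iot ℓ 6 ≠ bar ℓ r := by
          have := range_of hr; rw [bar]; split_ifs <;> omega
        rw [C.inv H, br0 _ (za_mem H _) _ (zi_mem hb') (za_ne nb) (zi_ne nb),
          br0 _ (add_mem (za_mem H _) hβ) _ (jIdx_add ℓ (zi_mem hr) hj)
            (by simp [h.2.1, za_ne (F := F) (ℓ := ℓ) (Ne.symm hrp')])
            (by simp [h.2.2, zi_ne (ℓ := ℓ) (Ne.symm hrp')])]
        simp)
  have hker : ∀ β ∈ Γ, ∀ j ∈ jIdx ℓ j0, β (p + iot ℓ 6) = 0 → j (p + iot ℓ 6) = 0 →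
      ψ (GG F ℓ Γ j0 p) (X F ℓ Γ j0 β j) = 0 := by
    intro β hβ j hj h h'
    by_cases hb0 : β 0 = 0
    · exact hker0 β hβ j hj ⟨hb0, h, h'⟩
    · have k := C.inv H (GG F ℓ Γ j0 p) (X F ℓ Γ j0 0 0) (X F ℓ Γ j0 β j)
      rw [br_one H hβ hj, br0 β hβ j hj h h', br0 _ (zero_mem _) _ (jIdx_zero _ _) rfl rfl,
        hj00 j hj] at k
      simpa [hb0] using k
  obtain ⟨f, hf⟩ := solve (r := p + iot ℓ 6) hs ((2 : F)⁻¹ • ψ (GG F ℓ Γ j0 p))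
    (fun β hβ j hj h h' => by simp [hker β hβ j hj h h'])
  refine exists_of_sub H f ?_
  have C' := C.sub H f
  set ψ' := ψ - (brL H).compr₂ f with hψ'
  have h1 : ψ' (GG F ℓ Γ j0 p) = 0 := by
    refine lin_ext fun β hβ j hj => ?_
    have k := hf β hβ j hj
    rw [hψ']
    simp only [LinearMap.sub_apply, LinearMap.compr₂_apply, brL_apply]
    rw [br_g H hp0 hp6 hl hβ hj]
    simp only [map_smul, map_add, smul_eq_mul, LinearMap.smul_apply] at k ⊢
    rw [k]; ring
  have h2 : (2 : F) ≠ 0 := two_ne_zero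
  by_cases hp3 : p ≤ iot ℓ 3
  · have hl' : p + iot ℓ 6 ∈ logS ℓ := by rw [mem_logS]; omega
    have hw : ψ' (WW F ℓ Γ j0 p) = 0 := by
      refine surj hs al _ fun β hβ j hj => ?_
      have k := C'.inv H (GG F ℓ Γ j0 p) (WW F ℓ Γ j0 p) (X F ℓ Γ j0 β j)
      rw [h1, brgw, br_g H hp0 hp6 hl hβ hj] at k
      simp only [map_smul, map_add, smul_eq_mul, LinearMap.smul_apply, LinearMap.zero_apply, h1]
        at k
      apply mul_left_cancel₀ h2
      linear_combination -k
    refine fin_lem (r := p + iot ℓ 6) (r' := p) n.symm 1 al fun β hβ j hj β' hβ' j' hj' => ?_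
    have k := C'.inv H (WW F ℓ Γ j0 p) (X F ℓ Γ j0 β j) (X F ℓ Γ j0 β' j')
    rw [hw, br_w H hp0 hp6 hβ hj, br_w H hp0 hp6 hβ' hj'] at k
    simp only [Er, if_pos hl, if_pos hl'] at k
    simp only [map_smul, map_add, map_sub, smul_eq_mul, LinearMap.smul_apply, LinearMap.add_apply,
      LinearMap.zero_apply, LinearMap.sub_apply] at k
    linear_combination -k
  · have hpol : p + iot ℓ 6 ∈ polS ℓ := by rw [mem_polS]; omega
    refine lin_ext ?_
    suffices ∀ m, ∀ β ∈ Γ, ∀ j ∈ jIdx ℓ j0, j (p + iot ℓ 6) = m → ψ' (X F ℓ Γ j0 β j) = 0 from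
      fun β hβ j hj => this _ β hβ j hj rfl
    intro m
    induction m with
    | zero =>
      intro β hβ j hj hm
      refine surj hs al _ fun β' hβ' j' hj' => ?_
      have k := C'.inv H (GG F ℓ Γ j0 p) (X F ℓ Γ j0 β j) (X F ℓ Γ j0 β' j')
      rw [h1, br0 β hβ j hj (H.h2 β hβ _ hpol) hm, br_g H hp0 hp6 hl hβ' hj'] at k
      simp only [map_smul, map_add, smul_eq_mul, LinearMap.smul_apply, LinearMap.zero_apply,
        map_zero] at k
      apply mul_left_cancel₀ h2
      linear_combination -k
    | succ m ih =>
      intro β hβ j hj hm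
      refine surj hs al _ fun β' hβ' j' hj' => ?_
      have k := C'.inv H (GG F ℓ Γ j0 p) (X F ℓ Γ j0 β j) (X F ℓ Γ j0 β' j')
      rw [h1, br_g H hp0 hp6 hl hβ hj, H.h2 β hβ _ hpol, br_g H hp0 hp6 hl hβ' hj'] at k
      simp only [map_smul, map_add, smul_eq_mul, LinearMap.smul_apply, LinearMap.zero_apply,
        map_zero, zero_smul, zero_add,
        ih _ (add_mem hβ hs) _ (jIdx_sub ℓ hj (es (p + iot ℓ 6))) (by simp [hm])] at k
      apply mul_left_cancel₀ h2
      linear_combination -k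

end CaseB
end KH2
end

noncomputable section
namespace KH2
set_option linter.unusedSectionVars false
set_option linter.unusedSimpArgs false

section CaseC
variable {F : Type*} [Field F] [CharZero F] {ℓ : ℕ → ℕ} {Γ : AddSubgroup (ℕ → F)} {j0 : Bool}

lemma N_lem {q : ℕ} (χ : (ℕ → ℕ) → (ℕ → ℕ) → F)
    (h : ∀ j j', (j q : F) * χ (j - es q) j' + (j' q : F) * χ j (j' - es q) = 0) : χ = 0 := by
  suffices ∀ m, ∀ j' : ℕ → ℕ, j' q = m → ∀ j, χ j j' = 0 from
    funext fun j => funext fun j' => this _ j' rfl j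
  intro m
  have e : ∀ j : ℕ → ℕ, ((j + es q) q : ℕ) = j q + 1 := by intro j; simp [es]
  induction m with
  | zero =>
    intro j' hj' j
    have k := h (j + es q) j'
    rw [hj', add_es_sub, e] at k
    have c := cast_ne (F := F) (j q)
    simpa [c] using k
  | succ m ih =>
    intro j' hj' j
    have k := h (j + es q) j'
    rw [add_es_sub, e, ih (j' - es q) (by simp [hj'])] at k
    have c := cast_ne (F := F) (j q)
    simpa [c] using k

abbrev VV (F : Type*) := (ℕ → ℕ) → (ℕ → ℕ) → F

def opL (F : Type*) [Field F] (p : ℕ) : Module.End F (VV F) where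
  toFun Ψ j j' := Ψ (j + es p) j'
  map_add' _ _ := rfl
  map_smul' _ _ := rfl
def opR (F : Type*) [Field F] (p : ℕ) : Module.End F (VV F) where
  toFun Ψ j j' := Ψ j (j' + es p)
  map_add' _ _ := rfl
  map_smul' _ _ := rfl
def opP (F : Type*) [Field F] (q : ℕ) : Module.End F (VV F) where
  toFun Ψ j j' := (j q : F) * Ψ (j - es q) j'
  map_add' _ _ := by funext j j'; simp [mul_add]
  map_smul' _ _ := by funext j j'; simp; ring
def opQ (F : Type*) [Field F] (q : ℕ) : Module.End F (VV F) where
  toFun Ψ j j' := (j' q : F) * Ψ j (j' - es q)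
  map_add' _ _ := by funext j j'; simp [mul_add]
  map_smul' _ _ := by funext j j'; simp; ring

lemma opL_apply (p : ℕ) (Ψ : VV F) (j j' : ℕ → ℕ) : opL F p Ψ j j' = Ψ (j + es p) j' := rfl
lemma opR_apply (p : ℕ) (Ψ : VV F) (j j' : ℕ → ℕ) : opR F p Ψ j j' = Ψ j (j' + es p) := rfl
lemma opP_apply (q : ℕ) (Ψ : VV F) (j j' : ℕ → ℕ) :
    opP F q Ψ j j' = (j q : F) * Ψ (j - es q) j' := rfl
lemma opQ_apply (q : ℕ) (Ψ : VV F) (j j' : ℕ → ℕ) :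
    opQ F q Ψ j j' = (j' q : F) * Ψ j (j' - es q) := rfl

lemma es_comm {p q : ℕ} (h : p ≠ q) (j : ℕ → ℕ) : j + es p - es q = j - es q + es p := by
  funext r
  by_cases h1 : r = p
  · subst h1; simp [es, h]
  · simp [es, h1]

lemma es_app {p q : ℕ} (h : p ≠ q) (j : ℕ → ℕ) : (j + es p) q = j q := by
  simp [es, h.symm]

/-- A polynomial identity, valid for commuting elements of an algebra. -/
lemma comm_id {A : Type*} [Ring A] [Algebra F A] (L R P Q : A) (a : F)
    (hLR : L * R = R * L) (hLP : L * P = P * L) (hLQ : L * Q = Q * L)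
    (hRP : R * P = P * R) (hRQ : R * Q = Q * R) (hPQ : P * Q = Q * P) :
    ∃ c1 c2 c3 : A, (P + Q) ^ 3 = c1 * (P + Q + (a • L - a • R)) + c2 * (P * L + Q * R)
      + c3 * ((3 : F) • (P * L ^ 2 + Q * R ^ 2) - (a • L ^ 3 - a • R ^ 3)) := by
  have hc : ∀ x ∈ ({L, R, P, Q} : Set A), ∀ y ∈ ({L, R, P, Q} : Set A), x * y = y * x := by
    intro x hx y hy
    simp only [Set.mem_insert_iff, Set.mem_singleton_iff] at hx hy
    rcases hx with rfl | rfl | rfl | rfl <;> rcases hy with rfl | rfl | rfl | rfl <;>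
      first
        | rfl
        | assumption
        | (symm; assumption)
  let _ : CommRing (Algebra.adjoin F ({L, R, P, Q} : Set A)) := Algebra.adjoinCommRingOfComm F hc
  have key : ∀ (B : Type _) [CommRing B] [Algebra F B] (L R P Q : B),
      (P + Q) ^ 3 = (algebraMap F B a ^ 2) *
        ((3 : F) • (P * L ^ 2 + Q * R ^ 2) - (a • L ^ 3 - a • R ^ 3))
      - (P + Q + (a • L - a • R)) * (3 * P * (a • L + a • R - (P + Q))
          - ((a • L) ^ 2 + (a • L) * (a • R - (P + Q)) + (a • R - (P + Q)) ^ 2))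
      - (a • (P * L + Q * R) - P * (P + Q + (a • L - a • R))) * (6 * (a • R) - 3 * (P + Q)) := by
    intro B _ _ L R P Q
    simp only [Algebra.smul_def, map_ofNat]
    ring
  have key2 : ∀ (B : Type _) [CommRing B] [Algebra F B] (L R P Q : B),
      ∃ c1 c2 c3 : B, (P + Q) ^ 3 = c1 * (P + Q + (a • L - a • R)) + c2 * (P * L + Q * R)
      + c3 * ((3 : F) • (P * L ^ 2 + Q * R ^ 2) - (a • L ^ 3 - a • R ^ 3)) := by
    intro B _ _ L R P Q
    refine ⟨-(3 * P * (a • L + a • R - (P + Q))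
          - ((a • L) ^ 2 + (a • L) * (a • R - (P + Q)) + (a • R - (P + Q)) ^ 2))
          + P * (6 * (a • R) - 3 * (P + Q)), - (algebraMap F B a * (6 * (a • R) - 3 * (P + Q))),
          algebraMap F B a ^ 2, ?_⟩
    rw [key B L R P Q]
    simp only [Algebra.smul_def, map_ofNat]
    ring
  obtain ⟨c1, c2, c3, h⟩ := key2 (Algebra.adjoin F ({L, R, P, Q} : Set A))
    ⟨L, Algebra.subset_adjoin (by simp)⟩ ⟨R, Algebra.subset_adjoin (by simp)⟩
    ⟨P, Algebra.subset_adjoin (by simp)⟩ ⟨Q, Algebra.subset_adjoin (by simp)⟩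
  exact ⟨c1, c2, c3, congrArg Subtype.val h⟩

lemma M_lem {p q : ℕ} (hpq : p ≠ q) (a : F) (Ψ : VV F)
    (h1 : ∀ j j', (j q : F) * Ψ (j - es q) j' + (j' q : F) * Ψ j (j' - es q)
      + (a * Ψ (j + es p) j' - a * Ψ j (j' + es p)) = 0)
    (h2 : ∀ j j', (j q : F) * Ψ (j - es q + es p) j' + (j' q : F) * Ψ j (j' - es q + es p) = 0)
    (h3 : ∀ j j', 3 * ((j q : F) * Ψ (j - es q + es p + es p) j'
      + (j' q : F) * Ψ j (j' - es q + es p + es p))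
      - (a * Ψ (j + es p + es p + es p) j' - a * Ψ j (j' + es p + es p + es p)) = 0) :
    Ψ = 0 := by
  obtain ⟨c1, c2, c3, h⟩ := comm_id (opL F p) (opR F p) (opP F q) (opQ F q) a
    (by ext Ψ j j'; rfl)
    (by ext Ψ j j'
        simp only [Module.End.mul_apply, opL_apply, opP_apply, es_comm hpq, es_app hpq])
    (by ext Ψ j j'; rfl) (by ext Ψ j j'; rfl)
    (by ext Ψ j j'
        simp only [Module.End.mul_apply, opR_apply, opQ_apply, es_comm hpq, es_app hpq])
    (by ext Ψ j j'
        simp only [Module.End.mul_apply, opP_apply, opQ_apply]; ring)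
  have e1 : (opP F q + opQ F q + (a • opL F p - a • opR F p)) Ψ = 0 := by
    funext j j'; exact h1 j j'
  have e2 : (opP F q * opL F p + opQ F q * opR F p) Ψ = 0 := by
    funext j j'; exact h2 j j'
  have e3 : ((3 : F) • (opP F q * opL F p ^ 2 + opQ F q * opR F p ^ 2)
      - (a • opL F p ^ 3 - a • opR F p ^ 3)) Ψ = 0 := by
    funext j j'
    exact h3 j j'
  have hs : ((opP F q + opQ F q) ^ 3) Ψ = 0 := by
    rw [h]
    simp only [LinearMap.add_apply, Module.End.mul_apply c1, Module.End.mul_apply c2,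
      Module.End.mul_apply c3] at e1 e2 e3 ⊢
    rw [e1, e2, e3]; simp
  have hN : ∀ χ : VV F, (opP F q + opQ F q) χ = 0 → χ = 0 := fun χ hχ =>
    N_lem (q := q) χ fun j j' => congrFun (congrFun hχ j) j'
  rw [pow_succ, pow_two, mul_assoc, Module.End.mul_apply, Module.End.mul_apply] at hs
  exact hN _ (hN _ (hN _ hs))

/-- The monomial `t_p^{k+1}`. -/
abbrev TT (F : Type*) [Field F] (ℓ : ℕ → ℕ) (Γ : AddSubgroup (ℕ → F)) (j0 : Bool) (p k : ℕ) :
    CA F ℓ Γ j0 := X F ℓ Γ j0 0 ((k + 1) • es p)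

lemma jIdx_congr {p q : ℕ} (hp : allow ℓ j0 p) (hq : allow ℓ j0 q) {i j : ℕ → ℕ}
    (h : ∀ r, r ≠ p → r ≠ q → i r = j r) (hi : i ∈ jIdx ℓ j0) : j ∈ jIdx ℓ j0 := by
  rw [mem_jIdx] at hi ⊢
  intro r hr
  rw [← h r (fun e => hr (e ▸ hp)) (fun e => hr (e ▸ hq))]
  exact hi r hr

lemma X_zero {β : ℕ → F} {j : ℕ → ℕ} (h : j ∉ jIdx ℓ j0) : X F ℓ Γ j0 β j = 0 := by
  simp [X, h]

lemma br_T (H : Hyp ℓ Γ j0) (hz : j0 = false) {p : ℕ} (hp1 : iot ℓ 5 + 1 ≤ p) (hp2 : p ≤ iot ℓ 6)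
    (k : ℕ) {β : ℕ → F} (hβ : β ∈ Γ) (j : ℕ → ℕ) :
    brk F ℓ Γ j0 (TT F ℓ Γ j0 p k) (X F ℓ Γ j0 β j) =
      (((k : F) + 1) * (j (p + iot ℓ 6) : F)) • X F ℓ Γ j0 β (j - es (p + iot ℓ 6) + k • es p)
        + ((1 - (k : F)) * β 0) • X F ℓ Γ j0 β (j + (k + 1) • es p) := by
  have hi := iot_mono ℓ
  have hp0 : 1 ≤ p := by omega
  have n : p ≠ p + iot ℓ 6 := by have := H.hn; omega
  have po : p ∈ polS ℓ := by rw [mem_polS]; omega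
  have po' : (p + iot ℓ 6) ∈ polS ℓ := by rw [mem_polS]; omega
  have nl := pol_not_log po
  have nl' := pol_not_log po'
  have ap : allow ℓ j0 p := pol_allow po
  have ap' : allow ℓ j0 (p + iot ℓ 6) := pol_allow po'
  by_cases hj : j ∈ jIdx ℓ j0
  swap
  · rw [X_zero hj, X_zero, X_zero, ← brL_apply H]
    · simp
    · intro h; exact hj (jIdx_congr ap ap' (by intro r h1 h2; simp [es, h1, h2]) h)
    · intro h; exact hj (jIdx_congr ap ap' (by intro r h1 h2; simp [es, h1, h2]) h)
  have m1 : j - es (p + iot ℓ 6) + k • es p ∈ jIdx ℓ j0 :=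
    jIdx_congr ap ap' (by intro r h1 h2; simp [es, h1, h2]) hj
  have m2 : j + (k + 1) • es p ∈ jIdx ℓ j0 :=
    jIdx_congr ap ap' (by intro r h1 h2; simp [es, h1, h2]) hj
  have m3 : (k + 1) • es p ∈ jIdx ℓ j0 :=
    jIdx_congr ap ap' (by intro r h1 h2; simp [es, h1, h2]) (jIdx_zero ℓ j0)
  have hj0 : j 0 = 0 := by
    rw [mem_jIdx] at hj
    apply hj; simp [allow, hz]
  have hdg : deg ℓ (0 : ℕ → F) ((k + 1) • es p) = k + 1 := by
    simp only [deg, Pi.zero_apply, Finset.sum_const_zero, zero_add]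
    rw [Finset.sum_eq_single p]
    · simp [es]
    · intro r _ hr; simp [es, hr]
    · intro h; exact absurd po h
  apply Phi_inj
  rw [Phi_brk H, Phi_X (zero_mem _) m3, Phi_X hβ hj, map_add, map_smul, map_smul,
    Phi_X hβ m1, Phi_X hβ m2]
  have hu0 : d00 F (mon (0 : ℕ → F) ((k + 1) • es p)) = 0 :=
    d00_mon_zero rfl (by simp [es, show (0 : ℕ) ≠ p by omega])
  have hu : ∀ r, r ≠ p → dl F ℓ r (mon (0 : ℕ → F) ((k + 1) • es p)) = 0 :=
    fun r h1 => dl_mon_zero rfl (by simp [es, h1])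
  have e1 : ((k + 1) • es p - es p : ℕ → ℕ) = k • es p := by rw [succ_nsmul, add_es_sub]
  have e2 : (((k + 1) • es p) p : ℕ) = k + 1 := by simp [es]
  rw [brB_one hp0 hp2 hu0 (fun r _ h1 _ => hu r h1), EE_mon, hdg, hu _ n.symm, dl_nlog nl,
    dl_nlog nl', dT_mon, dT_mon, d00_mon, e1, e2, hj0]
  have e3 : (2 * mon (0 : ℕ → F) ((k + 1) • es p) - ((k : F) + 1) • mon 0 ((k + 1) • es p))
      = (1 - (k : F)) • mon (0 : ℕ → F) ((k + 1) • es p) := by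
    simp only [two_mul, sub_smul, add_smul, one_smul]; abel
  rw [e3]
  simp only [Nat.cast_zero, zero_smul, add_zero, zero_mul, sub_zero, smul_mul_smul_comm, mon_mul,
    zero_add, Nat.cast_add, Nat.cast_one]
  rw [add_comm (k • es p), add_comm ((k + 1) • es p)]

lemma caseC (H : Hyp ℓ Γ j0) (hz : j0 = false) {p : ℕ} (hp1 : iot ℓ 5 + 1 ≤ p) (hp2 : p ≤ iot ℓ 6)
    {ψ : CA F ℓ Γ j0 →ₗ[F] CA F ℓ Γ j0 →ₗ[F] F} (C : Coc ψ) :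
    ∃ f : CA F ℓ Γ j0 →ₗ[F] F, ∀ u v : CA F ℓ Γ j0, ψ u v = f (brk F ℓ Γ j0 u v) := by
  classical
  have hi := iot_mono ℓ
  have hp0 : 1 ≤ p := by omega
  have n : p ≠ p + iot ℓ 6 := by have := H.hn; omega
  have po : p ∈ polS ℓ := by rw [mem_polS]; omega
  have po' : (p + iot ℓ 6) ∈ polS ℓ := by rw [mem_polS]; omega
  have nl := pol_not_log po
  have nl' := pol_not_log po'
  have ap : allow ℓ j0 p := pol_allow po
  have ap' : allow ℓ j0 (p + iot ℓ 6) := pol_allow po'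
  have hj00 : ∀ j ∈ jIdx ℓ j0, j 0 = 0 := by
    intro j hj
    rw [mem_jIdx] at hj
    apply hj; simp [allow, hz]
  have hT : ∀ k : ℕ, (k + 1) • es p ∈ jIdx ℓ j0 := fun k =>
    jIdx_congr ap ap' (by intro r h1 h2; simp [es, h1, h2]) (jIdx_zero ℓ j0)
  set q := p + iot ℓ 6 with hq
  have bT0 : ∀ β ∈ Γ, ∀ j, β 0 = 0 → brk F ℓ Γ j0 (TT F ℓ Γ j0 p 0) (X F ℓ Γ j0 β j) =
      (j q : F) • X F ℓ Γ j0 β (j - es q) := by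
    intro β hβ j h0
    rw [br_T H hz hp1 hp2 0 hβ j, h0]; simp [hq]
  -- `ψ(1, V₀) = 0`
  have one0 : ∀ β ∈ Γ, ∀ j ∈ jIdx ℓ j0, β 0 = 0 → ψ (X F ℓ Γ j0 0 0) (X F ℓ Γ j0 β j) = 0 := by
    intro β hβ j hj h0
    have hj' := jIdx_add ℓ hj (jIdx_es ℓ ap')
    have k := C.inv H (X F ℓ Γ j0 0 0) (TT F ℓ Γ j0 p 0) (X F ℓ Γ j0 β (j + es q))
    rw [bT0 β hβ _ h0, br_one_zero H (zero_mem _) (hT 0) rfl (hj00 _ (hT 0)),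
      br_one_zero H hβ hj' h0 (hj00 _ hj'), add_es_sub] at k
    have c := cast_ne (F := F) (j q)
    simpa [es, c] using k
  -- kernel condition
  have hker : ∀ β ∈ Γ, ∀ j ∈ jIdx ℓ j0, β 0 = 0 → j q = 0 →
      ψ (TT F ℓ Γ j0 p 0) (X F ℓ Γ j0 β j) = 0 := by
    intro β hβ j hj h0 hjq
    have k := C.inv H (TT F ℓ Γ j0 p 0) (WW F ℓ Γ j0 p) (X F ℓ Γ j0 β j)
    have e : brk F ℓ Γ j0 (TT F ℓ Γ j0 p 0) (WW F ℓ Γ j0 p) = TT F ℓ Γ j0 p 0 := by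
      rw [brk_skew H, br_w H hp0 hp2 (zero_mem _) (hT 0), Er, Er, if_neg nl, if_neg nl']
      have s1 : es p (p + iot ℓ 6) = 0 := Pi.single_eq_of_ne n.symm _
      have s2 : es p p = 1 := Pi.single_eq_same _ _
      simp [TT, s1, s2]
    rw [e, bT0 β hβ j h0, br_w H hp0 hp2 hβ hj, Er, Er, if_neg nl, if_neg nl', ← hq, hjq] at k
    simp only [Nat.cast_zero, zero_smul, map_zero, add_zero, zero_sub, map_neg, map_smul,
      smul_eq_mul] at k
    have c := cast_ne (F := F) (j p)
    have : ((j p : F) + 1) * ψ (TT F ℓ Γ j0 p 0) (X F ℓ Γ j0 β j) = 0 := by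
      linear_combination -k
    exact (mul_eq_zero.1 this).resolve_left c
  obtain ⟨f1, hf1⟩ := solve (r := q) (s := 0) (zero_mem Γ)
    (mkf (ℓ := ℓ) (Γ := Γ) (j0 := j0) fun β j =>
      if β 0 = 0 then ψ (TT F ℓ Γ j0 p 0) (X F ℓ Γ j0 β j) else 0)
    (fun β hβ j hj _ h' => by
      rw [mkf_X _ hβ hj]
      split_ifs with h0
      · exact hker β hβ j hj h0 h'
      · rfl)
  let f : CA F ℓ Γ j0 →ₗ[F] F := mkf fun β j =>
    if β 0 = 0 then f1 (X F ℓ Γ j0 β j) else ψ (X F ℓ Γ j0 0 0) (X F ℓ Γ j0 β j) / (2 * β 0)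
  have f0 : ∀ β ∈ Γ, ∀ j ∈ jIdx ℓ j0, β 0 = 0 → f (X F ℓ Γ j0 β j) = f1 (X F ℓ Γ j0 β j) := by
    intro β hβ j hj h0
    rw [mkf_X _ hβ hj, if_pos h0]
  have f2 : ∀ β ∈ Γ, ∀ j ∈ jIdx ℓ j0, β 0 ≠ 0 →
      2 * (β 0 * f (X F ℓ Γ j0 β j)) = ψ (X F ℓ Γ j0 0 0) (X F ℓ Γ j0 β j) := by
    intro β hβ j hj h0
    rw [mkf_X _ hβ hj, if_neg h0]
    field_simp
  refine exists_of_sub H f ?_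
  have C' := C.sub H f
  set ψ' := ψ - (brL H).compr₂ f with hψ'
  have h1 : ψ' (X F ℓ Γ j0 0 0) = 0 := by
    refine lin_ext fun β hβ j hj => ?_
    rw [hψ']
    simp only [LinearMap.sub_apply, LinearMap.compr₂_apply, brL_apply]
    rw [br_one H hβ hj, hj00 j hj]
    simp only [Nat.cast_zero, zero_smul, add_zero, map_smul, smul_eq_mul]
    by_cases h0 : β 0 = 0
    · rw [one0 β hβ j hj h0, h0]; simp
    · rw [f2 β hβ j hj h0]; simp
  have hgr : ∀ β ∈ Γ, ∀ j ∈ jIdx ℓ j0, ∀ β' ∈ Γ, ∀ j' ∈ jIdx ℓ j0, β 0 + β' 0 ≠ 0 →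
      ψ' (X F ℓ Γ j0 β j) (X F ℓ Γ j0 β' j') = 0 := by
    intro β hβ j hj β' hβ' j' hj' h
    have k := C'.inv H (X F ℓ Γ j0 0 0) (X F ℓ Γ j0 β j) (X F ℓ Γ j0 β' j')
    rw [h1, br_one H hβ hj, br_one H hβ' hj', hj00 j hj, hj00 j' hj'] at k
    simp only [Nat.cast_zero, zero_smul, add_zero, map_smul, smul_eq_mul, LinearMap.zero_apply,
      LinearMap.smul_apply] at k
    have h2 : (2 : F) * (β 0 + β' 0) ≠ 0 := mul_ne_zero two_ne_zero h
    have : (2 : F) * (β 0 + β' 0) * ψ' (X F ℓ Γ j0 β j) (X F ℓ Γ j0 β' j') = 0 := by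
      linear_combination -k
    exact (mul_eq_zero.1 this).resolve_left h2
  have hT0 : ψ' (TT F ℓ Γ j0 p 0) = 0 := by
    refine lin_ext fun β hβ j hj => ?_
    by_cases h0 : β 0 = 0
    · rw [hψ']
      simp only [LinearMap.sub_apply, LinearMap.compr₂_apply, brL_apply]
      rw [bT0 β hβ j h0, map_smul, f0 β hβ _ (jIdx_sub ℓ hj _) h0]
      have k := hf1 β hβ j hj
      rw [mkf_X _ hβ hj, if_pos h0, H.h2 β hβ _ po', add_zero] at k
      rw [smul_eq_mul]; linear_combination -k
    · exact hgr _ (zero_mem _) _ (hT 0) β hβ j hj (by simpa using h0)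
  have hV0 : ∀ β ∈ Γ, β 0 = 0 → ∀ j ∈ jIdx ℓ j0, ψ' (X F ℓ Γ j0 β j) = 0 := by
    intro β hβ h0 j hj
    refine lin_ext fun β' hβ' j' hj' => ?_
    by_cases h0' : β' 0 = 0
    · have := N_lem (F := F) (q := q) (fun j j' => ψ' (X F ℓ Γ j0 β j) (X F ℓ Γ j0 β' j'))
        (fun j j' => by
          have k := C'.inv H (TT F ℓ Γ j0 p 0) (X F ℓ Γ j0 β j) (X F ℓ Γ j0 β' j')
          rw [hT0, bT0 β hβ j h0, bT0 β' hβ' j' h0'] at k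
          simp only [map_smul, smul_eq_mul, LinearMap.zero_apply, LinearMap.smul_apply] at k
          exact k.symm)
      exact congrFun (congrFun this j) j'
    · exact hgr β hβ j hj β' hβ' j' hj' (by simpa [h0] using h0')
  refine bil_ext fun β hβ j hj β' hβ' j' hj' => ?_
  by_cases h : β 0 + β' 0 = 0
  swap
  · exact hgr β hβ j hj β' hβ' j' hj' h
  have hb : β' 0 = -β 0 := by linear_combination h
  have key : ∀ (k : ℕ) (j j' : ℕ → ℕ), 0 =
      ((k : F) + 1) * (j q : F) * ψ' (X F ℓ Γ j0 β (j - es q + k • es p)) (X F ℓ Γ j0 β' j')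
      + (1 - (k : F)) * β 0 * ψ' (X F ℓ Γ j0 β (j + (k + 1) • es p)) (X F ℓ Γ j0 β' j')
      + (((k : F) + 1) * (j' q : F) * ψ' (X F ℓ Γ j0 β j) (X F ℓ Γ j0 β' (j' - es q + k • es p))
      + (1 - (k : F)) * (-β 0) *
        ψ' (X F ℓ Γ j0 β j) (X F ℓ Γ j0 β' (j' + (k + 1) • es p))) := by
    intro k j j'
    have e := C'.inv H (TT F ℓ Γ j0 p k) (X F ℓ Γ j0 β j) (X F ℓ Γ j0 β' j')
    rw [hV0 0 (zero_mem _) rfl _ (hT k), br_T H hz hp1 hp2 k hβ j,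
      br_T H hz hp1 hp2 k hβ' j', hb] at e
    simp only [map_smul, map_add, smul_eq_mul, LinearMap.zero_apply, LinearMap.smul_apply,
      LinearMap.add_apply] at e
    exact e
  have fin := M_lem (F := F) n (β 0) (fun j j' => ψ' (X F ℓ Γ j0 β j) (X F ℓ Γ j0 β' j'))
    (fun j j' => by
      have e := key 0 j j'
      simp only [zero_nsmul, add_zero, zero_add, one_nsmul, Nat.cast_zero] at e
      linear_combination -e)
    (fun j j' => by
      have e := key 1 j j'
      simp only [one_nsmul, Nat.cast_one] at e
      have h2 : (2 : F) ≠ 0 := two_ne_zero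
      apply mul_left_cancel₀ h2
      linear_combination -e)
    (fun j j' => by
      have e := key 2 j j'
      simp only [succ_nsmul, zero_nsmul, zero_add, ← add_assoc] at e
      push_cast at e
      linear_combination -e)
  exact congrFun (congrFun fin j) j'

end CaseC
end KH2
end

/-- **Lemma 4.1.** If `𝒥₀ = ℕ` or `ι₆ ≠ ℓ₁`, then `H²(𝒦,F) = 0`: every
2-cocycle `ψ` on `𝒦` is a 2-coboundary, i.e. `ψ(u,v) = f([u,v])` for some linear
`f : 𝒦 → F`. -/
theorem H2_trivial_of_J0_or_ell
    {F : Type*} [Field F] [CharZero F] (ℓ : ℕ → ℕ) (Γ : AddSubgroup (ℕ → F)) (j0 : Bool)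
    (hℓ : 0 < iot ℓ 6)
    (hΓ1 : ∀ p ∈ jSet ℓ 1 3 ∪ iSet ℓ 4 5, (Pi.single p (1 : F) : ℕ → F) ∈ Γ)
    (hΓ2 : ∀ α ∈ Γ, ∀ p ∈ iSet ℓ 6 6 ∪ barSet ℓ (iSet ℓ 4 6), α p = 0)
    (hΓ3 : ∀ α ∈ Γ, ∀ p, 2 * iot ℓ 6 < p → α p = 0)
    (hΓ0 : (∃ α ∈ Γ, α 0 ≠ 0) → (Pi.single 0 (1 : F) : ℕ → F) ∈ Γ)
    (hJ0 : j0 = false → ∃ α ∈ Γ, α 0 ≠ 0)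
    (hcase : j0 = true ∨ iot ℓ 6 ≠ ℓ 1)
    (ψ : CA F ℓ Γ j0 →ₗ[F] CA F ℓ Γ j0 →ₗ[F] F)
    (hskew : ∀ u v : CA F ℓ Γ j0, ψ u v = -ψ v u)
    (hjac : ∀ u v w : CA F ℓ Γ j0,
      ψ (brk F ℓ Γ j0 u v) w + ψ (brk F ℓ Γ j0 v w) u + ψ (brk F ℓ Γ j0 w u) v = 0) :
    ∃ f : CA F ℓ Γ j0 →ₗ[F] F, ∀ u v : CA F ℓ Γ j0, ψ u v = f (brk F ℓ Γ j0 u v) := by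
  have H : KH2.Hyp ℓ Γ j0 := ⟨hΓ1, hΓ2, hℓ, fun h => hΓ0 (hJ0 h)⟩
  have C : KH2.Coc ψ := ⟨hskew, hjac⟩
  by_cases hz : j0 = true
  · exact KH2.caseA H hz C
  · have hz' : j0 = false := by simpa using hz
    have hne := hcase.resolve_left hz
    have hi := KH2.iot_mono ℓ
    by_cases h5 : iot ℓ 5 < iot ℓ 6
    · exact KH2.caseC H hz' (p := iot ℓ 6) (by omega) le_rfl C
    · exact KH2.caseB H hz' (p := iot ℓ 6) (by omega) (by omega) C

end
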